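/- arXiv:2403.03749 — 2 statements merged into one kernel-verified Lean document; each statement's English description precedes it below -/
import Mathlib

section
/- Let κ ∈ ℂ with Re(κ) < 1, let 0 < r₀ < r be real numbers and let γ ∈ ℝ. Set R := √(r² + r₀² − 2 r r₀ cos γ), x := r + r₀ + R and y := r + r₀ − R. Then the series (1/(r r₀)) Σ_{ℓ=0}^∞ (Γ(ℓ+1−κ)/(Γ(1−κ)·(2ℓ)!)) · M_{κ,ℓ+1/2}(r₀) · W_{κ,ℓ+1/2}(r) · P_ℓ(cos γ) converges, and its sum equals (1/R) · ( M′_{κ,1/2}(y/2) · W_{κ,1/2}(x/2) − M_{κ,1/2}(y/2) · W′_{κ,1/2}(x/2) ), where the primes denote derivatives with respect to the argument. -/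
open scoped BigOperators
open MeasureTheory

noncomputable section

/-- Ascending Pochhammer symbol `(a)_n = a (a+1) ⋯ (a+n-1)`. -/
def aP (n : ℕ) (a : ℂ) : ℂ := (ascPochhammer ℂ n).eval a

/-- The Whittaker function `M_{κ, ℓ+1/2}` as an entire function of `z`:
`M_{κ,ℓ+1/2}(z) = e^{-z/2} z^{ℓ+1} ∑_{n} ((ℓ+1-κ)_n / ((2ℓ+2)_n n!)) z^n`. -/
def whittakerM (κ : ℂ) (ℓ : ℕ) (z : ℂ) : ℂ :=
  Complex.exp (-z / 2) * z ^ (ℓ + 1) *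
    ∑' n : ℕ, aP n ((ℓ : ℂ) + 1 - κ) / (aP n (2 * (ℓ : ℂ) + 2) * (n.factorial : ℂ)) * z ^ n

/-- The Whittaker function `W_{κ,μ}(r)` for `r > 0`, `Re(μ-κ+1/2) > 0`, defined by the integral
representation `W_{κ,μ}(r) = e^{-r/2} r^κ Γ(μ-κ+1/2)⁻¹ ∫_0^∞ t^{μ-κ-1/2} (1+t/r)^{μ+κ-1/2} e^{-t} dt`. -/
def whittakerW (κ μ : ℂ) (r : ℝ) : ℂ :=
  Complex.exp (-(r : ℂ) / 2) * (r : ℂ) ^ κ * (Complex.Gamma (μ - κ + 1 / 2))⁻¹ *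
    ∫ t in Set.Ioi (0 : ℝ),
      (t : ℂ) ^ (μ - κ - 1 / 2) * ((1 + t / r : ℝ) : ℂ) ^ (μ + κ - 1 / 2) * Complex.exp (-(t : ℂ))

/-- The Legendre polynomial `P_ℓ`. -/
def legendreP (ℓ : ℕ) (x : ℝ) : ℝ :=
  (2 ^ ℓ : ℝ)⁻¹ * ∑ k ∈ Finset.range (ℓ / 2 + 1),
    (-1) ^ k * (ℓ.choose k : ℝ) * ((2 * ℓ - 2 * k).choose ℓ : ℝ) * x ^ (ℓ - 2 * k)

theorem hasDerivAt_tsum_pow {c : ℕ → ℂ} (hc : ∀ ρ : ℝ, 0 ≤ ρ → Summable fun n => ‖c n‖ * ρ ^ n)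
    (z : ℂ) :
    HasDerivAt (fun z : ℂ => ∑' n : ℕ, c n * z ^ n)
      (∑' n : ℕ, ((n : ℂ) + 1) * c (n + 1) * z ^ n) z := by
  set ρ : ℝ := ‖z‖ + 1 with hρ
  have hρ0 : 0 < ρ := by positivity
  have hbound : ∀ (n : ℕ) (y : ℂ), y ∈ Metric.ball (0 : ℂ) ρ →
      ‖c n * ((n : ℂ) * y ^ (n - 1))‖ ≤ ‖c n‖ * (2 * ρ) ^ n * ρ⁻¹ := by
    intro n y hy
    have hy' : ‖y‖ ≤ ρ := by simpa using (Metric.mem_ball.mp hy).le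
    rcases n with _ | n
    · simp; positivity
    · have h2 : ((n : ℝ) + 1) ≤ 2 ^ (n + 1) := by exact_mod_cast (Nat.lt_two_pow_self (n := n + 1)).le
      have hn : ‖((n : ℂ) + 1)‖ = (n : ℝ) + 1 := by
        rw [show ((n : ℂ) + 1) = ((n + 1 : ℕ) : ℂ) by push_cast; ring, Complex.norm_natCast]
        push_cast; ring
      have h3 : ‖y‖ ^ n ≤ ρ ^ n := by gcongr
      simp only [norm_mul, norm_pow, Nat.cast_add, Nat.cast_one, hn, Nat.add_sub_cancel]
      rw [mul_assoc ‖c (n + 1)‖]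
      refine mul_le_mul_of_nonneg_left ?_ (norm_nonneg _)
      calc ((n : ℝ) + 1) * ‖y‖ ^ n ≤ 2 ^ (n + 1) * ρ ^ n := by gcongr
        _ = (2 * ρ) ^ (n + 1) * ρ⁻¹ := by rw [mul_pow, pow_succ ρ]; field_simp
  have hz : z ∈ Metric.ball (0 : ℂ) ρ := by simp [hρ]
  have hs : Summable fun n : ℕ => c n * ((n : ℂ) * z ^ (n - 1)) :=
    .of_norm_bounded ((hc (2 * ρ) (by positivity)).mul_right ρ⁻¹) fun n => hbound n z hz
  have h := hasDerivAt_tsum_of_isPreconnected (𝕜 := ℂ) (t := Metric.ball (0 : ℂ) ρ)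
    (g := fun n y => c n * y ^ n) (g' := fun n y => c n * ((n : ℂ) * y ^ (n - 1)))
    (y₀ := 0) (y := z) ((hc (2 * ρ) (by positivity)).mul_right ρ⁻¹) Metric.isOpen_ball
    (convex_ball _ _).isPreconnected (fun n y _ => (hasDerivAt_pow n y).const_mul (c n)) hbound
    (by simpa using hρ0) (summable_of_ne_finset_zero (s := {0}) (by
      intro n hn; simp at hn; simp [hn])) hz
  refine h.congr_deriv ?_
  rw [hs.tsum_eq_zero_add]
  simp only [Nat.cast_zero, zero_mul, mul_zero, zero_add, Nat.add_sub_cancel]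
  exact tsum_congr fun n => by push_cast; ring

/-- The entire function `B_n(w) = ∑ wᵐ / (m! (m+n)!)`, so that `I_n(2√w) = w^{n/2} B_n(w)`. -/
def besselB (n : ℕ) (w : ℂ) : ℂ :=
  ∑' m : ℕ, ((m.factorial : ℂ) * ((m + n).factorial : ℂ))⁻¹ * w ^ m

theorem norm_besselB_coeff (n m : ℕ) :
    ‖((m.factorial : ℂ) * ((m + n).factorial : ℂ))⁻¹‖ =
      ((m.factorial : ℝ) * ((m + n).factorial : ℝ))⁻¹ := by
  rw [norm_inv, norm_mul, Complex.norm_natCast, Complex.norm_natCast]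

theorem summable_besselB_real (n : ℕ) (ρ : ℝ) (hρ : 0 ≤ ρ) :
    Summable fun m : ℕ => ((m.factorial : ℝ) * ((m + n).factorial : ℝ))⁻¹ * ρ ^ m := by
  refine .of_nonneg_of_le (fun m => by positivity) (fun m => ?_) (Real.summable_pow_div_factorial ρ)
  rw [div_eq_inv_mul]
  gcongr
  have : (1 : ℝ) ≤ ((m + n).factorial : ℝ) := by exact_mod_cast Nat.one_le_iff_ne_zero.2 (Nat.factorial_ne_zero _)
  nlinarith [show (0 : ℝ) < (m.factorial : ℝ) by positivity]

theorem summable_besselB_coeff (n : ℕ) (ρ : ℝ) (hρ : 0 ≤ ρ) :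
    Summable fun m : ℕ => ‖((m.factorial : ℂ) * ((m + n).factorial : ℂ))⁻¹‖ * ρ ^ m := by
  simp_rw [norm_besselB_coeff]
  exact summable_besselB_real n ρ hρ

theorem summable_norm_besselB (n : ℕ) (w : ℂ) :
    Summable fun m : ℕ => ‖((m.factorial : ℂ) * ((m + n).factorial : ℂ))⁻¹ * w ^ m‖ := by
  simpa only [norm_mul, norm_pow] using summable_besselB_coeff n ‖w‖ (norm_nonneg w)

theorem hasDerivAt_besselB (n : ℕ) (w : ℂ) :
    HasDerivAt (besselB n) (besselB (n + 1) w) w := by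
  have h := hasDerivAt_tsum_pow (summable_besselB_coeff n) w
  refine h.congr_deriv (tsum_congr fun m => ?_)
  rw [show m + 1 + n = m + (n + 1) by ring, Nat.factorial_succ m]
  have h1 : ((m : ℂ) + 1) ≠ 0 := by exact_mod_cast Nat.succ_ne_zero m
  have h2 : (m.factorial : ℂ) ≠ 0 := by exact_mod_cast m.factorial_ne_zero
  have h3 : ((m + (n + 1)).factorial : ℂ) ≠ 0 := by exact_mod_cast Nat.factorial_ne_zero _
  push_cast
  field_simp

theorem continuous_besselB (n : ℕ) : Continuous (besselB n) :=
  continuous_iff_continuousAt.2 fun w => (hasDerivAt_besselB n w).continuousAt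

theorem besselB_zero_right (n : ℕ) : besselB n 0 = (n.factorial : ℂ)⁻¹ := by
  rw [besselB, tsum_eq_single 0 (fun m hm => by simp [hm])]
  simp

theorem besselB_recurrence (n : ℕ) (w : ℂ) :
    w * besselB (n + 2) w + (n + 1) * besselB (n + 1) w = besselB n w := by
  have s0 := (summable_norm_besselB n w).of_norm
  have s1 := (summable_norm_besselB (n + 1) w).of_norm
  have s2 := (summable_norm_besselB (n + 2) w).of_norm
  simp only [besselB]
  rw [s0.tsum_eq_zero_add, s1.tsum_eq_zero_add, mul_add, ← tsum_mul_left, ← tsum_mul_left,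
    add_left_comm, ← Summable.tsum_add (s2.mul_left _) (((summable_nat_add_iff 1).2 s1).mul_left _)]
  have hf : ∀ k : ℕ, (k.factorial : ℂ) ≠ 0 := fun k => by exact_mod_cast k.factorial_ne_zero
  have hs : ∀ k : ℕ, (k : ℂ) + 1 ≠ 0 := fun k => by exact_mod_cast Nat.succ_ne_zero k
  congr 1
  · have := hs n
    have := hf n
    simp only [zero_add, Nat.factorial_succ n, Nat.factorial_zero, pow_zero]
    push_cast
    field_simp
  · refine tsum_congr fun m => ?_
    rw [show m + (n + 2) = (m + n + 1) + 1 by ring, show m + 1 + (n + 1) = (m + n + 1) + 1 by ring,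
      show m + 1 + n = m + n + 1 by ring, Nat.factorial_succ (m + n + 1), Nat.factorial_succ m]
    have h1 := hs m
    have h2 := hf m
    have h3 := hf (m + n + 1)
    have h4 := hs (m + n + 1)
    push_cast at h4 ⊢
    field_simp
    ring

theorem besselB_zero_sq_le (q : ℝ) :
    ∑' m : ℕ, ((m.factorial : ℝ) * (m.factorial : ℝ))⁻¹ * (q ^ 2) ^ m ≤ Real.cosh (2 * q) := by
  have h := Real.hasSum_cosh (2 * q)
  rw [← h.tsum_eq]
  refine Summable.tsum_le_tsum (fun m => ?_) (by simpa using summable_besselB_real 0 (q ^ 2) (sq_nonneg q)) h.summable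
  have hc : (((2 * m).factorial : ℕ) : ℝ) ≤ 4 ^ m * ((m.factorial : ℝ) * m.factorial) := by
    have h1 := Nat.choose_mul_factorial_mul_factorial (show m ≤ 2 * m by omega)
    have h2 := Nat.centralBinom_le_four_pow m
    rw [Nat.centralBinom_eq_two_mul_choose] at h2
    rw [show 2 * m - m = m by omega] at h1
    rw [← h1]
    push_cast
    rw [mul_assoc]
    gcongr
    exact_mod_cast h2
  rw [mul_pow, pow_mul, pow_mul, ← div_eq_inv_mul, div_le_div_iff₀ (by positivity) (by positivity)]
  norm_num
  nlinarith [show (0 : ℝ) ≤ (q ^ 2) ^ m by positivity]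

theorem norm_besselB_le (n : ℕ) (w : ℂ) : ‖besselB n w‖ ≤ Real.exp (2 * Real.sqrt ‖w‖) := by
  have h0 := norm_tsum_le_tsum_norm (summable_norm_besselB n w)
  refine h0.trans (le_trans ?_ ((besselB_zero_sq_le (Real.sqrt ‖w‖)).trans ?_))
  · rw [Real.sq_sqrt (norm_nonneg w)]
    refine Summable.tsum_le_tsum (fun m => ?_) (summable_norm_besselB n w)
      (by simpa using summable_besselB_real 0 ‖w‖ (norm_nonneg w))
    rw [norm_mul, norm_pow, norm_besselB_coeff]
    gcongr
    omega
  · rw [Real.cosh_eq]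
    have : Real.exp (-(2 * Real.sqrt ‖w‖)) ≤ Real.exp (2 * Real.sqrt ‖w‖) :=
      Real.exp_le_exp.2 (by linarith [Real.sqrt_nonneg ‖w‖])
    linarith

open Metric in
/-- Differentiation under the integral sign for a dominated family of holomorphic functions; the
derivatives are again dominated on a smaller ball. -/
theorem hasDerivAt_integral_of_dominated_holomorphic {α : Type*} [MeasurableSpace α]
    {μ : Measure α} {f f' : ℂ → α → ℂ} {g : α → ℝ} {z₀ : ℂ} {ε : ℝ} (hε : 0 < ε)
    (hmeas : ∀ z ∈ ball z₀ (2 * ε), AEStronglyMeasurable (f z) μ)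
    (hmeas' : AEStronglyMeasurable (f' z₀) μ)
    (hderiv : ∀ᵐ u ∂μ, ∀ z ∈ ball z₀ (2 * ε), HasDerivAt (fun z => f z u) (f' z u) z)
    (hbound : ∀ᵐ u ∂μ, ∀ z ∈ ball z₀ (2 * ε), ‖f z u‖ ≤ g u) (hg : Integrable g μ) :
    (∀ᵐ u ∂μ, ∀ z ∈ ball z₀ ε, ‖f' z u‖ ≤ g u / (ε / 2)) ∧ Integrable (f' z₀) μ ∧
      HasDerivAt (fun z => ∫ u, f z u ∂μ) (∫ u, f' z₀ u ∂μ) z₀ := by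
  have hb' : ∀ᵐ u ∂μ, ∀ z ∈ ball z₀ ε, ‖f' z u‖ ≤ g u / (ε / 2) := by
    filter_upwards [hderiv, hbound] with u hd hb z hz
    have hsub : closedBall z (ε / 2) ⊆ ball z₀ (2 * ε) := fun w hw => by
      rw [mem_ball] at hz ⊢
      rw [mem_closedBall] at hw
      linarith [dist_triangle w z z₀]
    have hz' : z ∈ ball z₀ (2 * ε) := hsub (mem_closedBall_self (by positivity))
    rw [← (hd z hz').deriv]
    refine Complex.norm_deriv_le_of_forall_mem_sphere_norm_le (by positivity) ?_
      fun w hw => hb w (hsub (sphere_subset_closedBall hw))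
    refine DifferentiableOn.diffContOnCl fun w hw => ?_
    exact (hd w (hsub (closure_ball_subset_closedBall hw))).differentiableAt.differentiableWithinAt
  have hz₀ : z₀ ∈ ball z₀ (2 * ε) := mem_ball_self (by positivity)
  refine ⟨hb', hasDerivAt_integral_of_dominated_loc_of_deriv_le (ball_mem_nhds z₀ hε) ?_ ?_ hmeas' hb'
    (hg.div_const _) ?_⟩
  · filter_upwards [ball_mem_nhds z₀ (show 0 < 2 * ε by positivity)] with z hz using hmeas z hz
  · exact hg.mono' (hmeas _ hz₀) (hbound.mono fun u hu => hu _ hz₀)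
  · exact hderiv.mono fun u hu z hz => hu z (ball_subset_ball (by linarith) hz)

/-- The power factor `u^{a-1} (1+u)^b` of the integrands. -/
def powerKernel (a b : ℂ) (u : ℝ) : ℂ := (u : ℂ) ^ (a - 1) * ((1 + u : ℝ) : ℂ) ^ b

theorem norm_powerKernel (a b : ℂ) {u : ℝ} (hu : 0 < u) :
    ‖powerKernel a b u‖ = u ^ (a.re - 1) * (1 + u) ^ b.re := by
  rw [powerKernel, norm_mul, Complex.norm_cpow_eq_rpow_re_of_pos hu,
    Complex.norm_cpow_eq_rpow_re_of_pos (by positivity)]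
  simp

theorem continuousOn_powerKernel (a b : ℂ) : ContinuousOn (powerKernel a b) (Set.Ioi 0) := by
  intro u hu
  have hu : 0 < u := hu
  have h1 : ContinuousAt (fun u : ℝ => (u : ℂ) ^ (a - 1)) u :=
    Complex.continuousAt_ofReal_cpow_const u _ (Or.inr hu.ne')
  have h2 : ContinuousAt (fun u : ℝ => ((1 + u : ℝ) : ℂ) ^ b) u :=
    (Complex.continuousAt_ofReal_cpow_const (1 + u) b (Or.inr (by positivity))).comp
      (f := fun u : ℝ => 1 + u) (by fun_prop)
  exact (h1.mul h2).continuousWithinAt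

theorem exists_one_add_rpow_le_exp (β : ℝ) {σ : ℝ} (hσ : 0 < σ) :
    ∃ C : ℝ, ∀ u : ℝ, 0 < u → (1 + u) ^ β ≤ C * Real.exp (σ * u) := by
  obtain ⟨n, hn⟩ := exists_nat_ge β
  refine ⟨n.factorial / σ ^ n * Real.exp σ, fun u hu => ?_⟩
  have h1 : (1 + u) ^ β ≤ (1 + u) ^ n := by
    rw [← Real.rpow_natCast]
    exact Real.rpow_le_rpow_of_exponent_le (by linarith) hn
  have h2 := Real.pow_div_factorial_le_exp (x := σ * (1 + u)) (by positivity) n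
  rw [mul_pow, mul_add, mul_one, Real.exp_add, div_le_iff₀ (by positivity)] at h2
  refine h1.trans ?_
  rw [mul_assoc, div_mul_eq_mul_div, le_div_iff₀ (by positivity)]
  linarith

theorem integrableOn_norm_powerKernel_mul_exp {a : ℂ} (b : ℂ) (ha : 0 < a.re) {σ : ℝ}
    (hσ : 0 < σ) :
    IntegrableOn (fun u => ‖powerKernel a b u‖ * Real.exp (-σ * u)) (Set.Ioi 0) := by
  obtain ⟨C, hC⟩ := exists_one_add_rpow_le_exp b.re (half_pos hσ)
  have h := (integrableOn_rpow_mul_exp_neg_mul_rpow (s := a.re - 1) (p := 1) (b := σ / 2)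
    (by linarith) one_pos (by positivity)).const_mul C
  refine h.mono' ?_ ?_
  · exact ((continuousOn_powerKernel a b).norm.mul (by fun_prop)).aestronglyMeasurable
      measurableSet_Ioi
  · filter_upwards [ae_restrict_mem measurableSet_Ioi] with u hu
    have hu : 0 < u := hu
    rw [Real.norm_of_nonneg (by positivity), norm_powerKernel a b hu, Real.rpow_one]
    have he : Real.exp (-σ * u) = Real.exp (-(σ / 2) * u) * Real.exp (-(σ / 2) * u) := by
      rw [← Real.exp_add]; ring_nf
    have he' : Real.exp (σ / 2 * u) * Real.exp (-(σ / 2) * u) = 1 := by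
      rw [← Real.exp_add]; ring_nf; simp
    calc u ^ (a.re - 1) * (1 + u) ^ b.re * Real.exp (-σ * u)
        ≤ u ^ (a.re - 1) * (C * Real.exp (σ / 2 * u)) * Real.exp (-σ * u) := by
          gcongr; exact hC u hu
      _ = C * (u ^ (a.re - 1) * Real.exp (-(σ / 2) * u)) *
            (Real.exp (σ / 2 * u) * Real.exp (-(σ / 2) * u)) := by rw [he]; ring
      _ = _ := by rw [he', mul_one]

theorem norm_exp_mul_besselB_le (n : ℕ) (s p : ℂ) {u : ℝ} (hu : 0 ≤ u) :
    ‖Complex.exp (-s * u) * besselB n (p * (u * (1 + u)))‖ ≤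
      Real.exp (Real.sqrt ‖p‖) * Real.exp (-(s.re - 2 * Real.sqrt ‖p‖) * u) := by
  have h := norm_besselB_le n (p * (u * (1 + u)))
  have h1 : ‖p * ((u : ℂ) * (1 + u))‖ = ‖p‖ * (u * (1 + u)) := by
    rw [norm_mul, show ((u : ℂ) * (1 + u)) = ((u * (1 + u) : ℝ) : ℂ) by push_cast; ring,
      Complex.norm_real, Real.norm_of_nonneg (by positivity)]
  have h2 : Real.sqrt (u * (1 + u)) ≤ u + 1 / 2 :=
    Real.sqrt_le_iff.2 ⟨by positivity, by nlinarith⟩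
  rw [h1, Real.sqrt_mul (norm_nonneg p)] at h
  rw [norm_mul, Complex.norm_exp, ← Real.exp_add]
  calc _ ≤ Real.exp ((-s * u).re) * Real.exp (2 * (Real.sqrt ‖p‖ * Real.sqrt (u * (1 + u)))) := by
        gcongr
    _ ≤ _ := by
        rw [← Real.exp_add]
        refine Real.exp_le_exp.2 ?_
        have := mul_le_mul_of_nonneg_left h2 (Real.sqrt_nonneg ‖p‖)
        simp
        nlinarith

/-- The integrand `u^{a-1} (1+u)^b e^{-su} B_n(p u (1+u))`. -/
def besselIntegrand (a b : ℂ) (n : ℕ) (s p : ℂ) (u : ℝ) : ℂ :=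
  powerKernel a b u * (Complex.exp (-s * u) * besselB n (p * (u * (1 + u))))

theorem continuousOn_besselIntegrand (a b : ℂ) (n : ℕ) (s p : ℂ) :
    ContinuousOn (besselIntegrand a b n s p) (Set.Ioi 0) := by
  refine (continuousOn_powerKernel a b).mul (Continuous.continuousOn ?_)
  exact (by fun_prop : Continuous fun u : ℝ => Complex.exp (-s * u)).mul
    ((continuous_besselB n).comp (by fun_prop))

theorem aestronglyMeasurable_besselIntegrand (a b : ℂ) (n : ℕ) (s p : ℂ) :
    AEStronglyMeasurable (besselIntegrand a b n s p) (volume.restrict (Set.Ioi 0)) :=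
  (continuousOn_besselIntegrand a b n s p).aestronglyMeasurable measurableSet_Ioi

theorem norm_besselIntegrand_le (a b : ℂ) (n : ℕ) {s p : ℂ} {A σ : ℝ}
    (hA : Real.sqrt ‖p‖ ≤ A) (hσ : σ ≤ s.re - 2 * Real.sqrt ‖p‖) {u : ℝ} (hu : 0 < u) :
    ‖besselIntegrand a b n s p u‖ ≤
      Real.exp A * (‖powerKernel a b u‖ * Real.exp (-σ * u)) := by
  rw [besselIntegrand, norm_mul]
  calc _ ≤ ‖powerKernel a b u‖ *
        (Real.exp (Real.sqrt ‖p‖) * Real.exp (-(s.re - 2 * Real.sqrt ‖p‖) * u)) := by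
        gcongr; exact norm_exp_mul_besselB_le n s p hu.le
    _ ≤ ‖powerKernel a b u‖ * (Real.exp A * Real.exp (-σ * u)) := by gcongr
    _ = _ := by ring

theorem integrableOn_besselIntegrand {a : ℂ} (b : ℂ) (n : ℕ) {s p : ℂ} (ha : 0 < a.re)
    (h : 2 * Real.sqrt ‖p‖ < s.re) :
    IntegrableOn (besselIntegrand a b n s p) (Set.Ioi 0) := by
  refine Integrable.mono' ((integrableOn_norm_powerKernel_mul_exp b ha (sub_pos.2 h)).const_mul
    (Real.exp (Real.sqrt ‖p‖))) (aestronglyMeasurable_besselIntegrand a b n s p) ?_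
  filter_upwards [ae_restrict_mem measurableSet_Ioi] with u hu
  exact norm_besselIntegrand_le a b n le_rfl le_rfl hu

/-- The region in which `∫ u^{a-1} (1+u)^b e^{-(X+Y)u} B_n(XY u (1+u)) du` is shown to be
holomorphic in `Y`. -/
def kummerRegion (X : ℝ) : Set ℂ :=
  {Y | 2 * Real.sqrt ‖(X : ℂ) * Y‖ - Y.re < X ∧ ‖Y‖ < X}

theorem isOpen_kummerRegion (X : ℝ) : IsOpen (kummerRegion X) :=
  (isOpen_lt (f := fun Y : ℂ => 2 * Real.sqrt ‖(X : ℂ) * Y‖ - Y.re) (g := fun _ => X) (by fun_prop)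
    continuous_const).inter (isOpen_lt (f := fun Y : ℂ => ‖Y‖) (g := fun _ => X) (by fun_prop)
    continuous_const)

theorem isPreconnected_kummerRegion {X : ℝ} (hX : 0 < X) : IsPreconnected (kummerRegion X) := by
  have hstar : StarConvex ℝ 0 (kummerRegion X) := by
    refine starConvex_zero_iff.2 fun Y hY t ht0 ht1 => ?_
    obtain ⟨h1, h2⟩ := hY
    rcases ht0.eq_or_lt with rfl | ht
    · simp [kummerRegion, hX]
    refine ⟨?_, ?_⟩
    · set p := Real.sqrt X
      set q := Real.sqrt ‖Y‖
      set τ := Real.sqrt t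
      have hp : p ^ 2 = X := Real.sq_sqrt hX.le
      have hq : q ^ 2 = ‖Y‖ := Real.sq_sqrt (norm_nonneg Y)
      have hτ : τ ^ 2 = t := Real.sq_sqrt ht0
      have hτ0 : 0 < τ := Real.sqrt_pos.2 ht
      have hτ1 : τ ≤ 1 := Real.sqrt_le_one.2 ht1
      have hp0 : 0 ≤ p := Real.sqrt_nonneg _
      have hq0 : 0 ≤ q := Real.sqrt_nonneg _
      have hqp : q < p := Real.sqrt_lt_sqrt (norm_nonneg Y) h2
      have e1 : Real.sqrt ‖(X : ℂ) * Y‖ = p * q := by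
        rw [norm_mul, Complex.norm_real, Real.norm_of_nonneg hX.le, Real.sqrt_mul hX.le]
      have e2 : Real.sqrt ‖(X : ℂ) * (t • Y)‖ = p * (τ * q) := by
        rw [norm_mul, norm_smul, Complex.norm_real, Real.norm_of_nonneg hX.le,
          Real.norm_of_nonneg ht0, Real.sqrt_mul hX.le, Real.sqrt_mul ht0]
      rw [e1] at h1
      rw [e2, Complex.real_smul, Complex.re_ofReal_mul, ← hτ, ← hp]
      have h3 : τ ^ 2 * (p - q) ^ 2 ≤ (p - τ * q) ^ 2 := by
        rw [← mul_pow]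
        exact pow_le_pow_left₀ (mul_nonneg hτ0.le (by linarith)) (by nlinarith) 2
      have h4 : τ ^ 2 * (q ^ 2 - Y.re) < τ ^ 2 * (p - q) ^ 2 := by
        refine mul_lt_mul_of_pos_left ?_ (by positivity)
        nlinarith
      nlinarith
    · rw [norm_smul, Real.norm_of_nonneg ht0]
      nlinarith [norm_nonneg Y]
  exact (hstar.isPathConnected (by simp [kummerRegion, hX])).isConnected.isPreconnected

theorem ofReal_mem_kummerRegion {X Y : ℝ} (hY : 0 ≤ Y) (hYX : Y < X) :
    (Y : ℂ) ∈ kummerRegion X := by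
  have hX : 0 < X := hY.trans_lt hYX
  refine ⟨?_, by rwa [Complex.norm_real, Real.norm_of_nonneg hY]⟩
  rw [norm_mul, Complex.norm_real, Complex.norm_real, Real.norm_of_nonneg hY,
    Real.norm_of_nonneg hX.le, Real.sqrt_mul hX.le, Complex.ofReal_re]
  have h1 := Real.sq_sqrt hX.le
  have h2 := Real.sq_sqrt hY
  have h3 := Real.sqrt_lt_sqrt hY hYX
  nlinarith [sq_pos_of_pos (sub_pos.2 h3)]

/-- The integrand of `∫ u^{a-1} (1+u)^{n-a} e^{-(X+Y)u} B_n(XY u (1+u)) du`. -/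
def kummerIntegrand (a : ℂ) (n : ℕ) (X : ℝ) (Y : ℂ) (u : ℝ) : ℂ :=
  besselIntegrand a (n - a) n (X + Y) (X * Y) u

/-- The derivative of `kummerIntegrand` in `Y`. -/
def kummerIntegrand' (a : ℂ) (n : ℕ) (X : ℝ) (Y : ℂ) (u : ℝ) : ℂ :=
  -u * besselIntegrand a (n - a) n (X + Y) (X * Y) u +
    X * u * (1 + u) * besselIntegrand a (n - a) (n + 1) (X + Y) (X * Y) u

/-- The second derivative of `kummerIntegrand` in `Y`. -/
def kummerIntegrand'' (a : ℂ) (n : ℕ) (X : ℝ) (Y : ℂ) (u : ℝ) : ℂ :=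
  u ^ 2 * besselIntegrand a (n - a) n (X + Y) (X * Y) u -
    2 * u * (X * u * (1 + u)) * besselIntegrand a (n - a) (n + 1) (X + Y) (X * Y) u +
    (X * u * (1 + u)) ^ 2 * besselIntegrand a (n - a) (n + 2) (X + Y) (X * Y) u

theorem hasDerivAt_besselIntegrand_add_mul (a b : ℂ) (n : ℕ) (X : ℝ) (Y : ℂ) (u : ℝ) :
    HasDerivAt (fun Y => besselIntegrand a b n (X + Y) (X * Y) u)
      (-u * besselIntegrand a b n (X + Y) (X * Y) u +
        X * u * (1 + u) * besselIntegrand a b (n + 1) (X + Y) (X * Y) u) Y := by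
  have h1 : HasDerivAt (fun Y : ℂ => Complex.exp (-(X + Y) * u))
      (Complex.exp (-(X + Y) * u) * (-1 * u)) Y :=
    ((((hasDerivAt_id Y).const_add (X : ℂ)).neg).mul_const (u : ℂ)).cexp
  have h2 : HasDerivAt (fun Y : ℂ => besselB n (X * Y * (u * (1 + u))))
      (besselB (n + 1) (X * Y * (u * (1 + u))) * (X * 1 * (u * (1 + u)))) Y :=
    (hasDerivAt_besselB n _).comp Y (((hasDerivAt_id Y).const_mul (X : ℂ)).mul_const _)
  refine ((h1.mul h2).const_mul (powerKernel a b u)).congr_deriv ?_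
  simp only [besselIntegrand]
  ring

theorem hasDerivAt_kummerIntegrand (a : ℂ) (n : ℕ) (X : ℝ) (Y : ℂ) (u : ℝ) :
    HasDerivAt (fun Y => kummerIntegrand a n X Y u) (kummerIntegrand' a n X Y u) Y :=
  hasDerivAt_besselIntegrand_add_mul _ _ _ _ _ _

theorem hasDerivAt_kummerIntegrand' (a : ℂ) (n : ℕ) (X : ℝ) (Y : ℂ) (u : ℝ) :
    HasDerivAt (fun Y => kummerIntegrand' a n X Y u) (kummerIntegrand'' a n X Y u) Y := by
  have h0 := hasDerivAt_besselIntegrand_add_mul a (n - a) n X Y u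
  have h1 := hasDerivAt_besselIntegrand_add_mul a (n - a) (n + 1) X Y u
  refine ((h0.const_mul (-u : ℂ)).add (h1.const_mul (X * u * (1 + u) : ℂ))).congr_deriv ?_
  simp only [kummerIntegrand'']
  ring

theorem continuousOn_kummerIntegrand' (a : ℂ) (n : ℕ) (X : ℝ) (Y : ℂ) :
    ContinuousOn (kummerIntegrand' a n X Y) (Set.Ioi 0) := by
  have h0 := continuousOn_besselIntegrand a (n - a) n (X + Y) (X * Y)
  have h1 := continuousOn_besselIntegrand a (n - a) (n + 1) (X + Y) (X * Y)
  unfold kummerIntegrand'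
  fun_prop

theorem continuousOn_kummerIntegrand'' (a : ℂ) (n : ℕ) (X : ℝ) (Y : ℂ) :
    ContinuousOn (kummerIntegrand'' a n X Y) (Set.Ioi 0) := by
  have h0 := continuousOn_besselIntegrand a (n - a) n (X + Y) (X * Y)
  have h1 := continuousOn_besselIntegrand a (n - a) (n + 1) (X + Y) (X * Y)
  have h2 := continuousOn_besselIntegrand a (n - a) (n + 2) (X + Y) (X * Y)
  unfold kummerIntegrand''
  fun_prop

theorem exists_ball_norm_kummerIntegrand_le {a : ℂ} (n : ℕ) {X : ℝ} (hX : 0 < X) (ha : 0 < a.re)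
    {Y₀ : ℂ} (hY₀ : Y₀ ∈ kummerRegion X) :
    ∃ ε > 0, ∃ g : ℝ → ℝ, IntegrableOn g (Set.Ioi 0) ∧
      ∀ u ∈ Set.Ioi (0 : ℝ), ∀ Y ∈ Metric.ball Y₀ ε, ‖kummerIntegrand a n X Y u‖ ≤ g u := by
  set v : ℂ → ℝ := fun Y => 2 * Real.sqrt ‖(X : ℂ) * Y‖ - Y.re with hv
  have hvc : Continuous v := by fun_prop
  obtain ⟨σ, hσ, hvσ⟩ : ∃ σ > 0, v Y₀ < X - σ :=
    ⟨(X - v Y₀) / 2, by linarith [show v Y₀ < X from hY₀.1], by linarith [show v Y₀ < X from hY₀.1]⟩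
  have hopen : IsOpen {Y : ℂ | v Y < X - σ ∧ ‖Y‖ < X} :=
    (isOpen_lt hvc continuous_const).inter (isOpen_lt continuous_norm continuous_const)
  obtain ⟨ε, hε, hball⟩ := Metric.isOpen_iff.1 hopen Y₀ ⟨hvσ, hY₀.2⟩
  refine ⟨ε, hε, _, (integrableOn_norm_powerKernel_mul_exp (n - a) ha hσ).const_mul (Real.exp X),
    fun u hu Y hY => ?_⟩
  obtain ⟨h1, h2⟩ := hball hY
  refine norm_besselIntegrand_le a (n - a) n ?_ ?_ hu
  · refine Real.sqrt_le_iff.2 ⟨hX.le, ?_⟩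
    rw [norm_mul, Complex.norm_real, Real.norm_of_nonneg hX.le, sq]
    gcongr
  · simp only [hv] at h1
    rw [Complex.add_re, Complex.ofReal_re]
    linarith

theorem hasDerivAt_integral_kummerIntegrand {a : ℂ} (n : ℕ) {X : ℝ} (hX : 0 < X) (ha : 0 < a.re)
    {Y : ℂ} (hY : Y ∈ kummerRegion X) :
    IntegrableOn (kummerIntegrand' a n X Y) (Set.Ioi 0) ∧
    IntegrableOn (kummerIntegrand'' a n X Y) (Set.Ioi 0) ∧
    HasDerivAt (fun Y => ∫ u in Set.Ioi (0 : ℝ), kummerIntegrand a n X Y u)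
      (∫ u in Set.Ioi (0 : ℝ), kummerIntegrand' a n X Y u) Y ∧
    HasDerivAt (fun Y => ∫ u in Set.Ioi (0 : ℝ), kummerIntegrand' a n X Y u)
      (∫ u in Set.Ioi (0 : ℝ), kummerIntegrand'' a n X Y u) Y := by
  obtain ⟨ε, hε, g, hg, hb⟩ := exists_ball_norm_kummerIntegrand_le n hX ha hY
  have hε4 : 0 < ε / 4 := by positivity
  have e1 : 2 * (2 * (ε / 4)) = ε := by ring
  obtain ⟨b1, i1, d1⟩ := hasDerivAt_integral_of_dominated_holomorphic
    (μ := volume.restrict (Set.Ioi (0 : ℝ))) (f := kummerIntegrand a n X)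
    (f' := kummerIntegrand' a n X) (z₀ := Y) (ε := 2 * (ε / 4)) (g := g) (by positivity)
    (fun Z _ => aestronglyMeasurable_besselIntegrand _ _ _ _ _)
    ((continuousOn_kummerIntegrand' a n X Y).aestronglyMeasurable measurableSet_Ioi)
    (.of_forall fun u Z _ => hasDerivAt_kummerIntegrand a n X Z u)
    (by rw [e1]; filter_upwards [ae_restrict_mem measurableSet_Ioi] with u hu using hb u hu) hg
  obtain ⟨-, i2, d2⟩ := hasDerivAt_integral_of_dominated_holomorphic
    (μ := volume.restrict (Set.Ioi (0 : ℝ))) (f := kummerIntegrand' a n X)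
    (f' := kummerIntegrand'' a n X) (z₀ := Y) (ε := ε / 4) hε4
    (fun Z _ => (continuousOn_kummerIntegrand' a n X Z).aestronglyMeasurable measurableSet_Ioi)
    ((continuousOn_kummerIntegrand'' a n X Y).aestronglyMeasurable measurableSet_Ioi)
    (.of_forall fun u Z _ => hasDerivAt_kummerIntegrand' a n X Z u) b1 (hg.div_const _)
  exact ⟨i1, i2, d1, d2⟩

theorem hasDerivAt_powerKernel (a b : ℂ) {u : ℝ} (hu : 0 < u) :
    HasDerivAt (powerKernel (a + 1) (b + 1))
      ((a * (1 + u) + (b + 1) * u) * powerKernel a b u) u := by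
  have hu' : (u : ℂ) ≠ 0 := by exact_mod_cast hu.ne'
  have hv : 0 < 1 + u := by positivity
  have hv' : ((1 + u : ℝ) : ℂ) ≠ 0 := by exact_mod_cast hv.ne'
  have h1 : HasDerivAt (fun u : ℝ => (u : ℂ) ^ (a + 1 - 1)) (a * (u : ℂ) ^ (a - 1)) u := by
    have := (hasDerivAt_id (u : ℂ)).cpow_const (c := a) (Or.inl (by simpa using hu))
    simpa using this.comp_ofReal
  have h2 : HasDerivAt (fun u : ℝ => ((1 + u : ℝ) : ℂ) ^ (b + 1))
      ((b + 1) * ((1 + u : ℝ) : ℂ) ^ b) u := by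
    have := ((hasDerivAt_id (u : ℂ)).const_add 1).cpow_const (c := b + 1)
      (Or.inl (by simpa using hv))
    simpa using this.comp_ofReal
  refine (h1.mul h2).congr_deriv ?_
  have e1 : (u : ℂ) ^ (a + 1 - 1) = (u : ℂ) ^ (a - 1) * u := by
    rw [add_sub_cancel_right, Complex.cpow_sub _ _ hu', Complex.cpow_one]; field_simp
  have e2 : ((1 + u : ℝ) : ℂ) ^ (b + 1) = ((1 + u : ℝ) : ℂ) ^ b * (1 + u) := by
    rw [Complex.cpow_add _ _ hv', Complex.cpow_one]; push_cast; ring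
  rw [e1, e2, powerKernel]
  ring

theorem hasDerivAt_exp_mul_besselB (n : ℕ) (s p : ℂ) (u : ℝ) :
    HasDerivAt (fun u : ℝ => Complex.exp (-s * u) * besselB n (p * (u * (1 + u))))
      (-s * (Complex.exp (-s * u) * besselB n (p * (u * (1 + u)))) +
        p * (1 + 2 * u) * (Complex.exp (-s * u) * besselB (n + 1) (p * (u * (1 + u))))) u := by
  have h1 : HasDerivAt (fun z : ℂ => Complex.exp (-s * z)) (Complex.exp (-s * u) * (-s * 1)) u :=
    ((hasDerivAt_id (u : ℂ)).const_mul (-s)).cexp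
  have h2 : HasDerivAt (fun z : ℂ => besselB n (p * (z * (1 + z))))
      (besselB (n + 1) (p * (u * (1 + u))) * (p * (1 * (1 + u) + u * 1))) u :=
    HasDerivAt.comp (u : ℂ) (hasDerivAt_besselB n _)
      (((hasDerivAt_id (u : ℂ)).mul ((hasDerivAt_id (u : ℂ)).const_add 1)).const_mul p)
  refine (h1.mul h2).comp_ofReal.congr_deriv ?_
  ring

theorem hasDerivAt_besselIntegrand_succ (a : ℂ) (n : ℕ) (X : ℝ) (Y : ℂ) {u : ℝ} (hu : 0 < u) :
    HasDerivAt (besselIntegrand (a + 1) (n - a + 1) n (X + Y) (X * Y))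
      (-(Y * kummerIntegrand'' a n X Y u + (n + 1 - Y) * kummerIntegrand' a n X Y u -
        a * kummerIntegrand a n X Y u)) u := by
  refine ((hasDerivAt_powerKernel a (n - a) hu).mul
    (hasDerivAt_exp_mul_besselB n (X + Y) (X * Y) u)).congr_deriv ?_
  have hu' : (u : ℂ) ≠ 0 := by exact_mod_cast hu.ne'
  have hv' : ((1 + u : ℝ) : ℂ) ≠ 0 := by exact_mod_cast (by positivity : 1 + u ≠ 0)
  have e1 : powerKernel (a + 1) (n - a + 1) u = u * (1 + u) * powerKernel a (n - a) u := by
    rw [powerKernel, powerKernel, Complex.cpow_add _ _ hv', Complex.cpow_one,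
      add_sub_cancel_right, Complex.cpow_sub _ _ hu', Complex.cpow_one]
    push_cast
    field_simp
  have e2 := besselB_recurrence n (X * Y * (u * (1 + u)))
  simp only [kummerIntegrand, kummerIntegrand', kummerIntegrand'', besselIntegrand, e1]
  rw [← e2]
  ring

theorem integral_kummerIntegrand_ode {a : ℂ} (n : ℕ) {X : ℝ} (hX : 0 < X) (ha : 0 < a.re)
    {Y : ℂ} (hY : Y ∈ kummerRegion X) :
    Y * (∫ u in Set.Ioi (0 : ℝ), kummerIntegrand'' a n X Y u) +
      (n + 1 - Y) * (∫ u in Set.Ioi (0 : ℝ), kummerIntegrand' a n X Y u) -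
      a * (∫ u in Set.Ioi (0 : ℝ), kummerIntegrand a n X Y u) = 0 := by
  obtain ⟨i1, i2, -, -⟩ := hasDerivAt_integral_kummerIntegrand n hX ha hY
  have hlt : 2 * Real.sqrt ‖(X : ℂ) * Y‖ < ((X : ℂ) + Y).re := by
    rw [Complex.add_re, Complex.ofReal_re]; linarith [hY.1]
  have i0 : IntegrableOn (kummerIntegrand a n X Y) (Set.Ioi 0) :=
    integrableOn_besselIntegrand _ n ha hlt
  have iS : IntegrableOn (besselIntegrand (a + 1) (n - a + 1) n (X + Y) (X * Y)) (Set.Ioi 0) :=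
    integrableOn_besselIntegrand _ n (by simp; linarith) hlt
  have i12 : IntegrableOn (fun u => Y * kummerIntegrand'' a n X Y u +
      (n + 1 - Y) * kummerIntegrand' a n X Y u) (Set.Ioi 0) :=
    (i2.const_mul Y).add (i1.const_mul (n + 1 - Y))
  have hsum : IntegrableOn (fun u => Y * kummerIntegrand'' a n X Y u +
      (n + 1 - Y) * kummerIntegrand' a n X Y u - a * kummerIntegrand a n X Y u) (Set.Ioi 0) :=
    i12.sub (i0.const_mul a)
  have hd : ∀ u ∈ Set.Ioi (0 : ℝ), HasDerivAt
      (besselIntegrand (a + 1) (n - a + 1) n (X + Y) (X * Y))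
      (-(Y * kummerIntegrand'' a n X Y u + (n + 1 - Y) * kummerIntegrand' a n X Y u -
        a * kummerIntegrand a n X Y u)) u :=
    fun u hu => hasDerivAt_besselIntegrand_succ a n X Y hu
  have hcont : ContinuousWithinAt (besselIntegrand (a + 1) (n - a + 1) n (X + Y) (X * Y))
      (Set.Ici 0) 0 := by
    have h1 : ContinuousAt (fun u : ℝ => (u : ℂ) ^ (a + 1 - 1)) 0 :=
      Complex.continuousAt_ofReal_cpow_const 0 _ (Or.inl (by simpa using ha))
    have h2 : ContinuousAt (fun u : ℝ => ((1 + u : ℝ) : ℂ) ^ (n - a + 1)) 0 :=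
      ContinuousAt.comp (f := fun u : ℝ => 1 + u)
        (Complex.continuousAt_ofReal_cpow_const (1 + 0) _ (Or.inr (by norm_num))) (by fun_prop)
    exact ((h1.mul h2).mul (Continuous.continuousAt
      ((by fun_prop : Continuous fun u : ℝ => Complex.exp (-(X + Y) * u)).mul
      ((continuous_besselB n).comp (by fun_prop))))).continuousWithinAt
  have h := integral_Ioi_of_hasDerivAt_of_tendsto hcont hd hsum.neg
    (tendsto_zero_of_hasDerivAt_of_integrableOn_Ioi hd hsum.neg iS)
  have h0 : besselIntegrand (a + 1) (n - a + 1) n (X + Y) (X * Y) 0 = 0 := by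
    have : a ≠ 0 := by rintro rfl; simp at ha
    simp [besselIntegrand, powerKernel, Complex.zero_cpow this]
  rw [h0, sub_zero, integral_neg, neg_eq_zero, integral_sub i12 (i0.const_mul a), integral_add (i2.const_mul Y)
    (i1.const_mul (n + 1 - Y)), integral_const_mul, integral_const_mul, integral_const_mul] at h
  exact h

theorem aP_succ (n : ℕ) (a : ℂ) : aP (n + 1) a = aP n a * (a + n) :=
  ascPochhammer_succ_eval n a

/-- Kummer's function `₁F₁(a; c; z)`. -/
def kummerPhi (a c z : ℂ) : ℂ := ∑' n : ℕ, aP n a / (aP n c * (n.factorial : ℂ)) * z ^ n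

theorem aP_natCast_succ_ne_zero (n m : ℕ) : aP m ((n : ℂ) + 1) ≠ 0 := by
  induction m with
  | zero => simp [aP]
  | succ m ih =>
    rw [aP_succ]
    exact mul_ne_zero ih (by exact_mod_cast (by positivity : n + 1 + m ≠ 0))

theorem norm_aP_le (a : ℂ) (n m : ℕ) :
    ‖aP m a‖ ≤ (‖a‖ + 1) ^ m * ‖aP m ((n : ℂ) + 1)‖ := by
  induction m with
  | zero => simp [aP]
  | succ m ih =>
    rw [aP_succ, aP_succ, norm_mul, norm_mul, pow_succ]
    have h1 : ‖(n : ℂ) + 1 + m‖ = (n : ℝ) + 1 + m := by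
      rw [show (n : ℂ) + 1 + m = ((n + 1 + m : ℕ) : ℂ) by push_cast; ring, Complex.norm_natCast]
      push_cast; ring
    have h2 : ‖a + m‖ ≤ (‖a‖ + 1) * ‖(n : ℂ) + 1 + m‖ := by
      have h3 := norm_add_le a (m : ℂ)
      rw [Complex.norm_natCast] at h3
      rw [h1]
      have : (0 : ℝ) ≤ ‖a‖ * (n + m) := by positivity
      have : (0 : ℝ) ≤ n := by positivity
      nlinarith
    calc _ ≤ ((‖a‖ + 1) ^ m * ‖aP m ((n : ℂ) + 1)‖) * ((‖a‖ + 1) * ‖(n : ℂ) + 1 + m‖) := by gcongr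
      _ = _ := by ring

theorem summable_kummerPhi_coeff (a : ℂ) (n : ℕ) (ρ : ℝ) (hρ : 0 ≤ ρ) :
    Summable fun m : ℕ => ‖aP m a / (aP m ((n : ℂ) + 1) * (m.factorial : ℂ))‖ * ρ ^ m := by
  refine .of_nonneg_of_le (fun m => by positivity) (fun m => ?_)
    (Real.summable_pow_div_factorial ((‖a‖ + 1) * ρ))
  have h := norm_aP_le a n m
  have hpos : 0 < ‖aP m ((n : ℂ) + 1)‖ := norm_pos_iff.2 (aP_natCast_succ_ne_zero n m)
  rw [norm_div, norm_mul, Complex.norm_natCast, mul_pow, mul_div_right_comm]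
  gcongr ?_ * _
  rw [div_le_div_iff₀ (by positivity) (by positivity)]
  nlinarith [show (0 : ℝ) < m.factorial by positivity]

theorem differentiable_kummerPhi (a : ℂ) (n : ℕ) : Differentiable ℂ (kummerPhi a ((n : ℂ) + 1)) :=
  fun z => (hasDerivAt_tsum_pow (summable_kummerPhi_coeff a n) z).differentiableAt

/-- A solution of Kummer's equation holomorphic on a connected neighbourhood of `0` is a multiple
of `₁F₁`. -/
theorem eqOn_kummerPhi_of_ode {a : ℂ} {n : ℕ} {U : Set ℂ} (hU : IsOpen U) (hUc : IsPreconnected U)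
    (h0 : (0 : ℂ) ∈ U) {F : ℂ → ℂ} (hF : DifferentiableOn ℂ F U)
    (hode : ∀ z ∈ U, z * deriv (deriv F) z + (n + 1 - z) * deriv F z - a * F z = 0) :
    Set.EqOn F (fun z => F 0 * kummerPhi a ((n : ℂ) + 1) z) U := by
  have hdiff : ∀ m, DifferentiableOn ℂ (iteratedDeriv m F) U := by
    intro m
    induction m with
    | zero => simpa using hF
    | succ m ih => rw [iteratedDeriv_succ]; exact ih.deriv hU
  have hder : ∀ m, ∀ z ∈ U, HasDerivAt (iteratedDeriv m F) (iteratedDeriv (m + 1) F z) z := by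
    intro m z hz
    rw [iteratedDeriv_succ]
    exact ((hdiff m).differentiableAt (hU.mem_nhds hz)).hasDerivAt
  have hode' : ∀ m : ℕ, ∀ z ∈ U, z * iteratedDeriv (m + 2) F z +
      (n + 1 + m - z) * iteratedDeriv (m + 1) F z - (a + m) * iteratedDeriv m F z = 0 := by
    intro m
    induction m with
    | zero =>
      intro z hz
      simpa [iteratedDeriv_succ] using hode z hz
    | succ m ih =>
      intro z hz
      have hd := (((hasDerivAt_id z).mul (hder (m + 2) z hz)).add
        (((hasDerivAt_id z).const_sub ((n : ℂ) + 1 + m)).mul (hder (m + 1) z hz))).sub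
        ((hder m z hz).const_mul (a + m))
      have hz0 : HasDerivAt (fun _ : ℂ => (0 : ℂ)) 0 z := hasDerivAt_const z 0
      have heq := hd.unique (hz0.congr_of_eventuallyEq (Filter.eventuallyEq_of_mem
        (hU.mem_nhds hz) fun w hw => ih w hw))
      push_cast
      simp only [id] at heq
      linear_combination heq
  have hcoeff : ∀ m, iteratedDeriv m F 0 * aP m ((n : ℂ) + 1) = aP m a * F 0 := by
    intro m
    induction m with
    | zero => simp [aP]
    | succ m ih =>
      have h := hode' m 0 h0
      rw [aP_succ, aP_succ]
      linear_combination aP m ((n : ℂ) + 1) * h + (a + m) * ih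
  obtain ⟨ρ, hρ, hball⟩ := Metric.isOpen_iff.1 hU 0 h0
  refine AnalyticOnNhd.eqOn_of_preconnected_of_eventuallyEq (hF.analyticOnNhd hU)
    (((differentiable_kummerPhi a n).const_mul (F 0)).differentiableOn.analyticOnNhd hU) hUc h0 ?_
  filter_upwards [Metric.ball_mem_nhds (0 : ℂ) hρ] with z hz
  have ht := Complex.hasSum_taylorSeries_on_ball (hF.mono hball) hz
  rw [← ht.tsum_eq, kummerPhi, ← tsum_mul_left]
  refine tsum_congr fun m => ?_
  have h1 := hcoeff m
  have h2 := aP_natCast_succ_ne_zero n m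
  have h3 : (m.factorial : ℂ) ≠ 0 := by exact_mod_cast m.factorial_ne_zero
  rw [smul_eq_mul, smul_eq_mul, sub_zero]
  field_simp
  linear_combination z ^ m * h1

theorem integral_kummerIntegrand {a : ℂ} (n : ℕ) {X : ℝ} (hX : 0 < X) (ha : 0 < a.re)
    {Y : ℂ} (hY : Y ∈ kummerRegion X) :
    ∫ u in Set.Ioi (0 : ℝ), besselIntegrand a (n - a) n (X + Y) (X * Y) u =
      (n.factorial : ℂ)⁻¹ *
        (∫ u in Set.Ioi (0 : ℝ), powerKernel a (n - a) u * Complex.exp (-X * u)) *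
        kummerPhi a ((n : ℂ) + 1) Y := by
  have h0 : (0 : ℂ) ∈ kummerRegion X := by simp [kummerRegion, hX]
  have hU := isOpen_kummerRegion X
  have hd : ∀ z ∈ kummerRegion X, HasDerivAt _ _ z := fun z hz =>
    (hasDerivAt_integral_kummerIntegrand n hX ha hz).2.2.1
  have h := eqOn_kummerPhi_of_ode (a := a) (n := n) hU (isPreconnected_kummerRegion hX) h0
    (F := fun Y => ∫ u in Set.Ioi (0 : ℝ), kummerIntegrand a n X Y u)
    (fun z hz => (hd z hz).differentiableAt.differentiableWithinAt) (fun z hz => by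
      have e1 := (hd z hz).deriv
      have e2 := ((hasDerivAt_integral_kummerIntegrand n hX ha hz).2.2.2.congr_of_eventuallyEq
        (Filter.eventuallyEq_of_mem (hU.mem_nhds hz) fun w hw => (hd w hw).deriv)).deriv
      rw [e1, e2]
      exact integral_kummerIntegrand_ode n hX ha hz) hY
  refine h.trans ?_
  simp only [kummerIntegrand, besselIntegrand, mul_zero, zero_mul, besselB_zero_right, add_zero]
  rw [← integral_const_mul]
  congr 1
  exact integral_congr_ae (.of_forall fun u => by ring)

theorem legendreP_eq_sum_range (ℓ : ℕ) (x : ℝ) {N : ℕ} (hN : ℓ / 2 + 1 ≤ N) :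
    legendreP ℓ x = (2 ^ ℓ : ℝ)⁻¹ * ∑ k ∈ Finset.range N,
      (-1) ^ k * (ℓ.choose k : ℝ) * ((2 * ℓ - 2 * k).choose ℓ : ℝ) * x ^ (ℓ - 2 * k) := by
  rw [legendreP]
  congr 1
  refine Finset.sum_subset (Finset.range_mono hN) fun k _ hk => ?_
  have hk : ℓ / 2 + 1 ≤ k := by simpa using hk
  rcases le_or_gt k ℓ with h | h
  · rw [Nat.choose_eq_zero_of_lt (show 2 * ℓ - 2 * k < ℓ by omega)]; simp
  · rw [Nat.choose_eq_zero_of_lt h]; simp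

theorem choose_mul_choose_legendre (k j : ℕ) :
    ((2 * k + j).choose k : ℝ) * ((2 * k + 2 * j).choose (2 * k + j) : ℝ) =
      ((2 * k + 2 * j).factorial : ℝ) / (k.factorial * (k + j).factorial * j.factorial) := by
  have h1 := Nat.choose_mul_factorial_mul_factorial (show k ≤ 2 * k + j by omega)
  have h2 := Nat.choose_mul_factorial_mul_factorial (show 2 * k + j ≤ 2 * k + 2 * j by omega)
  rw [show 2 * k + j - k = k + j by omega] at h1
  rw [show 2 * k + 2 * j - (2 * k + j) = j by omega, ← h1] at h2
  rw [eq_div_iff (by positivity), ← h2]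
  push_cast
  ring

theorem legendreP_zero (x : ℝ) : legendreP 0 x = 1 := by simp [legendreP]

theorem legendreP_one (x : ℝ) : legendreP 1 x = x := by simp [legendreP]

theorem legendreP_recurrence (ℓ : ℕ) (x : ℝ) :
    (ℓ + 2) * legendreP (ℓ + 2) x =
      (2 * ℓ + 3) * x * legendreP (ℓ + 1) x - (ℓ + 1) * legendreP ℓ x := by
  rw [legendreP_eq_sum_range (ℓ + 2) x (N := ℓ / 2 + 1 + 1) (by omega),
    legendreP_eq_sum_range (ℓ + 1) x (N := ℓ / 2 + 1 + 1) (by omega), legendreP,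
    Finset.sum_range_succ' _ (ℓ / 2 + 1), Finset.sum_range_succ' _ (ℓ / 2 + 1)]
  have hzero : (ℓ + 2 : ℝ) / 4 * ((2 * (ℓ + 2)).choose (ℓ + 2) : ℝ) =
      (2 * ℓ + 3) / 2 * ((2 * (ℓ + 1)).choose (ℓ + 1) : ℝ) := by
    have := Nat.succ_mul_centralBinom_succ (ℓ + 1)
    rw [Nat.centralBinom_eq_two_mul_choose, Nat.centralBinom_eq_two_mul_choose] at this
    have := congrArg (Nat.cast (R := ℝ)) this
    push_cast at this
    norm_num [add_assoc] at this ⊢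
    linarith
  have hsucc : ∀ k ∈ Finset.range (ℓ / 2 + 1),
      (ℓ + 2 : ℝ) / 4 * ((-1) ^ (k + 1) * ((ℓ + 2).choose (k + 1) : ℝ) *
        ((2 * (ℓ + 2) - 2 * (k + 1)).choose (ℓ + 2) : ℝ) * x ^ (ℓ + 2 - 2 * (k + 1))) =
      (2 * ℓ + 3) / 2 * x * ((-1) ^ (k + 1) * ((ℓ + 1).choose (k + 1) : ℝ) *
        ((2 * (ℓ + 1) - 2 * (k + 1)).choose (ℓ + 1) : ℝ) * x ^ (ℓ + 1 - 2 * (k + 1))) -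
      (ℓ + 1) * ((-1) ^ k * (ℓ.choose k : ℝ) *
        ((2 * ℓ - 2 * k).choose ℓ : ℝ) * x ^ (ℓ - 2 * k)) := by
    intro k hk
    have hk : k < ℓ / 2 + 1 := by simpa using hk
    obtain ⟨j, rfl⟩ : ∃ j, ℓ = 2 * k + j := ⟨ℓ - 2 * k, by omega⟩
    have e0 := choose_mul_choose_legendre k j
    have e2 := choose_mul_choose_legendre (k + 1) j
    rw [show 2 * (2 * k + j + 2) - 2 * (k + 1) = 2 * (k + 1) + 2 * j by omega,
      show 2 * k + j + 2 = 2 * (k + 1) + j by omega,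
      show 2 * (k + 1) + j - 2 * (k + 1) = j by omega,
      show 2 * (2 * k + j) - 2 * k = 2 * k + 2 * j by omega,
      show 2 * k + j - 2 * k = j by omega, mul_assoc ((-1 : ℝ) ^ (k + 1)), e2,
      mul_assoc ((-1 : ℝ) ^ k), e0]
    rcases j with _ | j
    · rw [Nat.choose_eq_zero_of_lt (show 2 * (2 * k + 0 + 1) - 2 * (k + 1) < 2 * k + 0 + 1 by omega)]
      rw [show 2 * (k + 1) + 2 * 0 = 2 * k + 1 + 1 by ring, show k + 1 + 0 = k + 1 by ring,
        Nat.factorial_succ, Nat.factorial_succ, Nat.factorial_succ, pow_succ]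
      push_cast
      field_simp
      ring_nf
    · have e1 := choose_mul_choose_legendre (k + 1) j
      rw [show 2 * (2 * k + (j + 1) + 1) - 2 * (k + 1) = 2 * (k + 1) + 2 * j by omega,
        show 2 * k + (j + 1) + 1 = 2 * (k + 1) + j by omega,
        show 2 * (k + 1) + j - 2 * (k + 1) = j by omega, mul_assoc ((-1 : ℝ) ^ (k + 1)) (((2 * (k + 1) + j).choose (k + 1) : ℕ) : ℝ), e1,
        show 2 * (k + 1) + 2 * (j + 1) = 2 * k + 2 * j + 1 + 1 + 1 + 1 by ring,
        show 2 * (k + 1) + 2 * j = 2 * k + 2 * j + 1 + 1 by ring,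
        show 2 * k + 2 * (j + 1) = 2 * k + 2 * j + 1 + 1 by ring,
        show k + 1 + (j + 1) = k + j + 1 + 1 by ring, show k + 1 + j = k + j + 1 by ring,
        show k + (j + 1) = k + j + 1 by ring]
      simp only [Nat.factorial_succ, pow_succ]
      push_cast
      field_simp
      ring
  have hsum := Finset.sum_congr rfl hsucc
  rw [Finset.sum_sub_distrib, ← Finset.mul_sum, ← Finset.mul_sum, ← Finset.mul_sum] at hsum
  simp only [pow_zero, Nat.choose_zero_right, Nat.cast_one, mul_zero, Nat.sub_zero, one_mul,
    mul_one]
  have h2 : (2 : ℝ) ^ ℓ ≠ 0 := by positivity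
  simp only [pow_succ (2 : ℝ) (ℓ + 1), pow_succ (2 : ℝ) ℓ]
  field_simp
  linear_combination 4 * hsum + 4 * x ^ (ℓ + 2) * hzero

theorem legendreP_one_right (ℓ : ℕ) : legendreP ℓ 1 = 1 := by
  induction ℓ using Nat.twoStepInduction with
  | zero => exact legendreP_zero 1
  | one => exact legendreP_one 1
  | more ℓ h0 h1 =>
    have h := legendreP_recurrence ℓ 1
    rw [h0, h1] at h
    have : (ℓ + 2 : ℝ) ≠ 0 := by positivity
    exact mul_left_cancel₀ this (by linarith)

/-- The coefficients of `(1 - z)^{-1/2}`. -/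
def invSqrtCoeff (j : ℕ) : ℝ := (j.centralBinom : ℝ) / 4 ^ j

theorem invSqrtCoeff_succ (j : ℕ) : (j + 1) * invSqrtCoeff (j + 1) = (j + 1 / 2) * invSqrtCoeff j := by
  have := congrArg (Nat.cast (R := ℝ)) (Nat.succ_mul_centralBinom_succ j)
  push_cast at this
  rw [invSqrtCoeff, invSqrtCoeff, pow_succ]
  field_simp
  linarith

/-- The power series `(1 - e z)^{-1/2}`. -/
def invSqrtSeries (e : ℂ) : PowerSeries ℂ := PowerSeries.mk fun j => (invSqrtCoeff j : ℂ) * e ^ j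

theorem derivative_invSqrtSeries (e : ℂ) :
    (1 - PowerSeries.C e * PowerSeries.X) * PowerSeries.derivative ℂ (invSqrtSeries e) =
      PowerSeries.C (e / 2) * invSqrtSeries e := by
  ext n
  have h : ∀ j : ℕ, ((j : ℂ) + 1) * ((invSqrtCoeff (j + 1) : ℝ) : ℂ) =
      (j + 1 / 2) * ((invSqrtCoeff j : ℝ) : ℂ) := by
    intro j
    have := congrArg Complex.ofReal (invSqrtCoeff_succ j)
    push_cast at this
    exact this
  rw [sub_mul, one_mul, map_sub, mul_assoc, PowerSeries.coeff_C_mul, PowerSeries.coeff_C_mul,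
    PowerSeries.coeff_derivative]
  have h2 : PowerSeries.coeff n (PowerSeries.X * PowerSeries.derivative ℂ (invSqrtSeries e)) =
      PowerSeries.coeff n (invSqrtSeries e) * n := by
    rcases n with _ | n
    · simp
    · rw [PowerSeries.coeff_succ_X_mul, PowerSeries.coeff_derivative]; push_cast; ring
  rw [h2]
  simp only [invSqrtSeries, PowerSeries.coeff_mk]
  have := h n
  rw [pow_succ]
  linear_combination e ^ n * e * this

theorem coeff_invSqrtSeries_mul_recurrence {e f : ℂ} (hef : e * f = 1) (n : ℕ) :
    (n + 2) * PowerSeries.coeff (n + 2) (invSqrtSeries e * invSqrtSeries f) =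
      (2 * n + 3) * ((e + f) / 2) *
          PowerSeries.coeff (n + 1) (invSqrtSeries e * invSqrtSeries f) -
        (n + 1) * PowerSeries.coeff n (invSqrtSeries e * invSqrtSeries f) := by
  set G := invSqrtSeries e * invSqrtSeries f with hG
  have h1 := derivative_invSqrtSeries e
  have h2 := derivative_invSqrtSeries f
  have hD : PowerSeries.derivative ℂ G = invSqrtSeries e * PowerSeries.derivative ℂ (invSqrtSeries f) +
      invSqrtSeries f * PowerSeries.derivative ℂ (invSqrtSeries e) := by
    rw [hG, Derivation.leibniz, smul_eq_mul, smul_eq_mul]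
  have hC : PowerSeries.C e * PowerSeries.C f = (1 : PowerSeries ℂ) := by
    rw [← map_mul, hef, map_one]
  have he : PowerSeries.C e = (PowerSeries.C (e / 2) + PowerSeries.C (e / 2) : PowerSeries ℂ) := by
    rw [← map_add]; congr 1; ring
  have hf : PowerSeries.C f = (PowerSeries.C (f / 2) + PowerSeries.C (f / 2) : PowerSeries ℂ) := by
    rw [← map_add]; congr 1; ring
  have hc : PowerSeries.C ((e + f) / 2) =
      (PowerSeries.C (e / 2) + PowerSeries.C (f / 2) : PowerSeries ℂ) := by
    rw [← map_add]; congr 1; ring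
  have hc2 : PowerSeries.C e + PowerSeries.C f =
      (PowerSeries.C ((e + f) / 2) + PowerSeries.C ((e + f) / 2) : PowerSeries ℂ) := by
    rw [hc, he, hf, ← he, ← hf]; linear_combination he + hf
  have hX : ∀ m, PowerSeries.coeff m (PowerSeries.X * PowerSeries.derivative ℂ G) =
      PowerSeries.coeff m G * m := by
    rintro (_ | m)
    · simp
    · rw [PowerSeries.coeff_succ_X_mul, PowerSeries.coeff_derivative]; push_cast; ring
  have key : PowerSeries.derivative ℂ G + PowerSeries.X * (PowerSeries.X * PowerSeries.derivative ℂ G)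
      = PowerSeries.C ((e + f) / 2) * (PowerSeries.X * PowerSeries.derivative ℂ G) +
        PowerSeries.C ((e + f) / 2) * (PowerSeries.X * PowerSeries.derivative ℂ G) +
        PowerSeries.C ((e + f) / 2) * G - PowerSeries.X * G := by
    have hC' : PowerSeries.C e * PowerSeries.C (f / 2) +
        PowerSeries.C f * PowerSeries.C (e / 2) = (1 : PowerSeries ℂ) := by
      rw [← map_mul, ← map_mul, ← map_add, ← map_one PowerSeries.C]
      congr 1
      linear_combination hef
    have k1 : (1 - PowerSeries.C e * PowerSeries.X) * (1 - PowerSeries.C f * PowerSeries.X) *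
        PowerSeries.derivative ℂ G = (PowerSeries.C ((e + f) / 2) - PowerSeries.X) * G := by
      rw [hD, hc]
      linear_combination (1 - PowerSeries.C e * PowerSeries.X) * invSqrtSeries e * h2 +
        (1 - PowerSeries.C f * PowerSeries.X) * invSqrtSeries f * h1 -
        PowerSeries.X * G * hC'
    linear_combination k1 - PowerSeries.X ^ 2 * PowerSeries.derivative ℂ G * hC +
      PowerSeries.X * PowerSeries.derivative ℂ G * hc2
  have hk := congrArg (PowerSeries.coeff (n + 1)) key
  simp only [map_add, map_sub, PowerSeries.coeff_C_mul, PowerSeries.coeff_succ_X_mul, hX,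
    PowerSeries.coeff_derivative] at hk
  push_cast at hk
  linear_combination hk

theorem legendreP_eq_coeff {e f : ℂ} (hef : e * f = 1) {x : ℝ} (hx : (x : ℂ) = (e + f) / 2) (n : ℕ) :
    (legendreP n x : ℂ) = PowerSeries.coeff n (invSqrtSeries e * invSqrtSeries f) := by
  induction n using Nat.twoStepInduction with
  | zero => simp [legendreP_zero, invSqrtSeries, invSqrtCoeff, PowerSeries.coeff_mul]
  | one =>
    rw [legendreP_one, hx, PowerSeries.coeff_mul, Finset.Nat.antidiagonal_succ]
    simp [invSqrtSeries, invSqrtCoeff, Nat.centralBinom]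
    ring
  | more n h0 h1 =>
    have h := congrArg Complex.ofReal (legendreP_recurrence n x)
    push_cast at h
    rw [h0, h1, hx, ← coeff_invSqrtSeries_mul_recurrence hef n] at h
    exact mul_left_cancel₀ (by exact_mod_cast (by positivity : n + 2 ≠ 0)) h

theorem abs_legendreP_cos_le_one (n : ℕ) (γ : ℝ) : |legendreP n (Real.cos γ)| ≤ 1 := by
  have h := legendreP_eq_coeff (e := Complex.exp (γ * Complex.I)) (f := Complex.exp (-γ * Complex.I))
    (x := Real.cos γ) (by rw [← Complex.exp_add]; simp)
    (by rw [Complex.ofReal_cos, Complex.cos]) n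
  have h1 := legendreP_eq_coeff (e := 1) (f := 1) (x := 1) (by simp) (by norm_num) n
  rw [legendreP_one_right, PowerSeries.coeff_mul] at h1
  rw [PowerSeries.coeff_mul] at h
  rw [← Real.norm_eq_abs, ← Complex.norm_real, h]
  refine (norm_sum_le _ _).trans (le_of_eq ?_)
  simp only [invSqrtSeries, PowerSeries.coeff_mk, one_pow, mul_one] at h1 ⊢
  have h1' : (1 : ℝ) = ∑ p ∈ Finset.HasAntidiagonal.antidiagonal n, invSqrtCoeff p.1 * invSqrtCoeff p.2 := by
    exact_mod_cast h1
  rw [h1']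
  refine Finset.sum_congr rfl fun p _ => ?_
  have hpos : ∀ j, 0 ≤ invSqrtCoeff j := fun j => by unfold invSqrtCoeff; positivity
  have e1 : ‖Complex.exp (γ * Complex.I)‖ = 1 := Complex.norm_exp_ofReal_mul_I γ
  have e2 : ‖Complex.exp (-γ * Complex.I)‖ = 1 := by
    simpa using Complex.norm_exp_ofReal_mul_I (-γ)
  simp only [norm_mul, norm_pow, e1, e2, one_pow, mul_one, Complex.norm_real,
    Real.norm_of_nonneg (hpos _)]

/-- The coefficient `1 / ((n - ℓ)! (n + ℓ + 1)!)`, extended by `0` to `ℓ > n`. -/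
def legendreCoeff (n ℓ : ℕ) : ℝ :=
  if ℓ ≤ n then (((n - ℓ).factorial : ℝ) * ((n + ℓ + 1).factorial : ℝ))⁻¹ else 0

theorem legendreCoeff_of_lt {n ℓ : ℕ} (h : n < ℓ) : legendreCoeff n ℓ = 0 := by
  rw [legendreCoeff, if_neg (by omega)]

theorem legendreCoeff_add (m ℓ : ℕ) :
    legendreCoeff (ℓ + m) ℓ = ((m.factorial : ℝ) * ((m + (2 * ℓ + 1)).factorial : ℝ))⁻¹ := by
  rw [legendreCoeff, if_pos (by omega), show ℓ + m - ℓ = m by omega,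
    show ℓ + m + ℓ + 1 = m + (2 * ℓ + 1) by ring]

theorem legendreCoeff_succ_left (n ℓ : ℕ) :
    legendreCoeff n ℓ = (n + 1 - ℓ) * (n + ℓ + 2) * legendreCoeff (n + 1) ℓ := by
  rcases lt_trichotomy ℓ (n + 1) with h | rfl | h
  · obtain ⟨m, rfl⟩ : ∃ m, n = ℓ + m := ⟨n - ℓ, by omega⟩
    rw [legendreCoeff_add, add_assoc ℓ m 1, legendreCoeff_add,
      show m + 1 + (2 * ℓ + 1) = m + (2 * ℓ + 1) + 1 by ring, Nat.factorial_succ,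
      Nat.factorial_succ (m + _)]
    push_cast
    field_simp
    ring
  · rw [legendreCoeff_of_lt (by omega)]; push_cast; ring
  · rw [legendreCoeff_of_lt (by omega), legendreCoeff_of_lt (by omega)]; ring

theorem legendreCoeff_succ_right (n ℓ : ℕ) :
    (n - ℓ) * legendreCoeff n ℓ = (n + ℓ + 2) * legendreCoeff n (ℓ + 1) := by
  rcases lt_trichotomy ℓ n with h | rfl | h
  · obtain ⟨m, rfl⟩ : ∃ m, n = ℓ + (m + 1) := ⟨n - ℓ - 1, by omega⟩
    rw [legendreCoeff_add, show ℓ + (m + 1) = ℓ + 1 + m by ring, legendreCoeff_add,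
      show m + 1 + (2 * ℓ + 1) = m + 2 * ℓ + 1 + 1 by ring,
      show m + (2 * (ℓ + 1) + 1) = m + 2 * ℓ + 1 + 1 + 1 by ring, Nat.factorial_succ m,
      Nat.factorial_succ (m + 2 * ℓ + 1 + 1)]
    push_cast
    field_simp
    ring
  · rw [legendreCoeff_of_lt (show ℓ < ℓ + 1 by omega)]; ring
  · rw [legendreCoeff_of_lt (by omega), legendreCoeff_of_lt (by omega)]; ring

theorem sum_legendreP_mul_legendreCoeff_telescope (n M : ℕ) (x : ℝ) :
    ∑ ℓ ∈ Finset.range (M + 1), (2 * ℓ + 1) * legendreP ℓ x *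
        ((1 + x) * legendreCoeff n ℓ - 2 * (n + 1) ^ 2 * legendreCoeff (n + 1) ℓ) =
      (M + 1) * (legendreP (M + 1) x * legendreCoeff n M -
        legendreP M x * legendreCoeff n (M + 1)) := by
  induction M with
  | zero =>
    rw [Finset.sum_range_one, legendreP_zero, legendreP_one]
    have h1 := legendreCoeff_succ_left n 0
    have h2 := legendreCoeff_succ_left n 1
    have h3 := legendreCoeff_succ_right (n + 1) 0
    push_cast at h1 h2 h3 ⊢
    linear_combination h1 + h2 - n * h3
  | succ M ih =>
    rw [Finset.sum_range_succ, ih]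
    have hrec := legendreP_recurrence M x
    have h0 := legendreCoeff_succ_left n M
    have h1 := legendreCoeff_succ_left n (M + 1)
    have h2 := legendreCoeff_succ_left n (M + 2)
    have h3 := legendreCoeff_succ_right (n + 1) M
    have h4 := legendreCoeff_succ_right (n + 1) (M + 1)
    rw [show M + 1 + 1 = M + 2 from rfl] at *
    push_cast at *
    linear_combination (-legendreCoeff n (M + 1)) * hrec +
      legendreP (M + 1) x * ((2 * M + 3) * h1 + (M + 1) * h0 + (M + 2) * h2 +
        (M + 1) * (n + M + 2) * h3 - (M + 2) * (n - M - 1) * h4)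

theorem sum_legendreP_mul_legendreCoeff (n : ℕ) (x : ℝ) :
    ∑ ℓ ∈ Finset.range (n + 1), (2 * ℓ + 1) * legendreP ℓ x * legendreCoeff n ℓ =
      ((1 + x) / 2) ^ n * ((n.factorial : ℝ) * n.factorial)⁻¹ := by
  induction n with
  | zero => simp [legendreP_zero, legendreCoeff]
  | succ n ih =>
    have h := sum_legendreP_mul_legendreCoeff_telescope n (n + 1) x
    rw [legendreCoeff_of_lt (show n < n + 1 by omega),
      legendreCoeff_of_lt (show n < n + 1 + 1 by omega)] at h
    have e1 : ∑ ℓ ∈ Finset.range (n + 1 + 1), (2 * ℓ + 1) * legendreP ℓ x * legendreCoeff n ℓ =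
        ((1 + x) / 2) ^ n * ((n.factorial : ℝ) * n.factorial)⁻¹ := by
      rw [Finset.sum_range_succ, ih, legendreCoeff_of_lt (show n < n + 1 by omega)]; ring
    have e2 : (1 + x) * ∑ ℓ ∈ Finset.range (n + 1 + 1),
          (2 * ℓ + 1) * legendreP ℓ x * legendreCoeff n ℓ -
        2 * (n + 1) ^ 2 * ∑ ℓ ∈ Finset.range (n + 1 + 1),
          (2 * ℓ + 1) * legendreP ℓ x * legendreCoeff (n + 1) ℓ = 0 := by
      rw [Finset.mul_sum, Finset.mul_sum, ← Finset.sum_sub_distrib]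
      refine Eq.trans (Finset.sum_congr rfl fun ℓ _ => ?_) (h.trans ?_) <;> ring
    rw [e1] at e2
    have hn : (2 * (n + 1) ^ 2 : ℝ) ≠ 0 := by positivity
    refine mul_left_cancel₀ hn ?_
    rw [Nat.factorial_succ, pow_succ]
    push_cast
    have e3 : ((n + 1 : ℝ) * n.factorial * ((n + 1) * n.factorial))⁻¹ * (n + 1) ^ 2 =
        ((n.factorial : ℝ) * n.factorial)⁻¹ := by
      field_simp
    linear_combination -e2 - (1 + x) * ((1 + x) / 2) ^ n * e3

theorem summable_legendreP_mul_besselB_coeff {x : ℝ} (hx : ∀ ℓ, |legendreP ℓ x| ≤ 1) (w : ℂ) :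
    Summable fun q : ℕ × ℕ => ((2 * q.1 + 1) * legendreP q.1 x * legendreCoeff (q.1 + q.2) q.1 : ℝ) *
      w ^ (q.1 + q.2) := by
  have h := (NormedSpace.expSeries_div_summable (𝔸 := ℝ) ‖w‖).mul_of_nonneg
    (NormedSpace.expSeries_div_summable (𝔸 := ℝ) ‖w‖) (fun _ => by positivity) (fun _ => by positivity)
  refine Summable.of_norm_bounded h fun ⟨ℓ, m⟩ => ?_
  rw [norm_mul, norm_pow, Complex.norm_real, Real.norm_eq_abs, abs_mul, abs_mul]
  simp only
  rw [legendreCoeff_add, abs_of_nonneg (by positivity : (0 : ℝ) ≤ 2 * ℓ + 1),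
    abs_of_nonneg (by positivity : (0 : ℝ) ≤ ((m.factorial : ℝ) * ((m + (2 * ℓ + 1)).factorial))⁻¹)]
  have h1 : (2 * ℓ + 1 : ℝ) * ((m.factorial : ℝ) * ((m + (2 * ℓ + 1)).factorial))⁻¹ ≤
      ((ℓ.factorial : ℝ) * m.factorial)⁻¹ := by
    have h2 : (2 * ℓ + 1) * ℓ.factorial ≤ (m + (2 * ℓ + 1)).factorial := by
      calc (2 * ℓ + 1) * ℓ.factorial ≤ (2 * ℓ + 1) * (2 * ℓ).factorial :=
            Nat.mul_le_mul_left _ (Nat.factorial_le (by omega))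
        _ = (2 * ℓ + 1).factorial := (Nat.factorial_succ _).symm
        _ ≤ _ := Nat.factorial_le (by omega)
    have h2 : (2 * ℓ + 1 : ℝ) * ℓ.factorial ≤ (m + (2 * ℓ + 1)).factorial := by exact_mod_cast h2
    rw [← div_eq_mul_inv, div_le_iff₀ (by positivity), inv_mul_eq_div, le_div_iff₀ (by positivity)]
    have : (0 : ℝ) ≤ m.factorial := by positivity
    nlinarith
  calc (2 * ℓ + 1 : ℝ) * |legendreP ℓ x| * ((m.factorial : ℝ) * ((m + (2 * ℓ + 1)).factorial))⁻¹ *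
        ‖w‖ ^ (ℓ + m) ≤ (2 * ℓ + 1 : ℝ) * 1 * ((m.factorial : ℝ) * ((m + (2 * ℓ + 1)).factorial))⁻¹ *
        ‖w‖ ^ (ℓ + m) := by gcongr; exact hx ℓ
    _ ≤ ((ℓ.factorial : ℝ) * m.factorial)⁻¹ * ‖w‖ ^ (ℓ + m) := by rw [mul_one]; gcongr
    _ = _ := by rw [pow_add, mul_inv]; ring

/-- Expansion of the Bessel function of order `0` in Legendre polynomials. -/
theorem hasSum_legendreP_mul_besselB {x : ℝ} (hx : ∀ ℓ, |legendreP ℓ x| ≤ 1) (w : ℂ) :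
    HasSum (fun ℓ : ℕ => ((2 * ℓ + 1) * legendreP ℓ x : ℝ) * (w ^ ℓ * besselB (2 * ℓ + 1) w))
      (besselB 0 (w * ((1 + x) / 2 : ℝ))) := by
  have hs := summable_legendreP_mul_besselB_coeff hx w
  have hfib : ∀ ℓ : ℕ, HasSum (fun m : ℕ =>
      (((2 * ℓ + 1) * legendreP ℓ x * legendreCoeff (ℓ + m) ℓ : ℝ) : ℂ) * w ^ (ℓ + m))
      (((2 * ℓ + 1) * legendreP ℓ x : ℝ) * (w ^ ℓ * besselB (2 * ℓ + 1) w)) := by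
    intro ℓ
    have := ((summable_norm_besselB (2 * ℓ + 1) w).of_norm.hasSum.mul_left (w ^ ℓ)).mul_left
      ((((2 * ℓ + 1) * legendreP ℓ x : ℝ)) : ℂ)
    refine this.congr_fun ?_
    intro m
    rw [legendreCoeff_add, pow_add]
    push_cast
    ring
  have htot : HasSum (fun q : ℕ × ℕ =>
      (((2 * q.1 + 1) * legendreP q.1 x * legendreCoeff (q.1 + q.2) q.1 : ℝ) : ℂ) * w ^ (q.1 + q.2))
      (besselB 0 (w * ((1 + x) / 2 : ℝ))) := by
    have hσ := (Finset.HasAntidiagonal.sigmaAntidiagonalEquivProd (A := ℕ)).summable_iff.mpr hs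
    have h1 := hσ.hasSum.sigma fun n => hasSum_fintype _
    have h2 := (Finset.HasAntidiagonal.sigmaAntidiagonalEquivProd (A := ℕ)).hasSum_iff.mp hσ.hasSum
    convert h2 using 1
    refine HasSum.unique ?_ h1
    have h3 := (summable_norm_besselB 0 (w * ((1 + x) / 2 : ℝ))).of_norm.hasSum
    refine h3.congr_fun fun n => ?_
    refine (Finset.sum_coe_sort (Finset.HasAntidiagonal.antidiagonal n) fun q : ℕ × ℕ =>
      (((2 * q.1 + 1) * legendreP q.1 x * legendreCoeff (q.1 + q.2) q.1 : ℝ) : ℂ) *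
        w ^ (q.1 + q.2)).trans ?_
    rw [Finset.Nat.sum_antidiagonal_eq_sum_range_succ_mk]
    have h4 : ∀ ℓ ∈ Finset.range n.succ,
        (((2 * ℓ + 1) * legendreP ℓ x * legendreCoeff (ℓ + (n - ℓ)) ℓ : ℝ) : ℂ) *
          w ^ (ℓ + (n - ℓ)) =
        (((2 * ℓ + 1) * legendreP ℓ x * legendreCoeff n ℓ : ℝ) : ℂ) * w ^ n := by
      intro ℓ hℓ
      have : ℓ ≤ n := Nat.lt_succ_iff.mp (Finset.mem_range.mp hℓ)
      rw [Nat.add_sub_cancel' this]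
    rw [Finset.sum_congr rfl h4, ← Finset.sum_mul, ← Complex.ofReal_sum,
      sum_legendreP_mul_legendreCoeff, mul_pow]
    push_cast
    ring_nf
  exact htot.prod_fiberwise hfib

theorem besselB_ofReal_eq_norm (n : ℕ) {ρ : ℝ} (hρ : 0 ≤ ρ) :
    besselB n ρ = (‖besselB n ρ‖ : ℝ) := by
  have h : besselB n ρ = ((∑' m : ℕ, ((m.factorial : ℝ) * ((m + n).factorial : ℝ))⁻¹ * ρ ^ m : ℝ) : ℂ) := by
    rw [besselB, Complex.ofReal_tsum]
    push_cast
    rfl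
  have h0 : 0 ≤ ∑' m : ℕ, ((m.factorial : ℝ) * ((m + n).factorial : ℝ))⁻¹ * ρ ^ m :=
    tsum_nonneg fun m => by positivity
  rw [h, Complex.norm_real, Real.norm_of_nonneg h0]

theorem hasSum_norm_besselB {ρ : ℝ} (hρ : 0 ≤ ρ) :
    HasSum (fun ℓ : ℕ => (2 * ℓ + 1 : ℝ) * (ρ ^ ℓ * ‖besselB (2 * ℓ + 1) ρ‖)) ‖besselB 0 ρ‖ := by
  have h := hasSum_legendreP_mul_besselB (x := 1) (fun ℓ => by simp [legendreP_one_right]) (ρ : ℂ)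
  rw [show ((ρ : ℂ) * (((1 + 1) / 2 : ℝ) : ℂ)) = ρ by norm_num, besselB_ofReal_eq_norm 0 hρ] at h
  rw [← Complex.hasSum_ofReal]
  refine h.congr_fun fun ℓ => ?_
  rw [legendreP_one_right, besselB_ofReal_eq_norm (2 * ℓ + 1) hρ]
  rw [Complex.norm_real, norm_norm]
  push_cast
  ring

theorem powerKernel_add_natCast (a b : ℂ) (ℓ : ℕ) {u : ℝ} (hu : 0 < u) :
    powerKernel (a + ℓ) (b + ℓ) u = powerKernel a b u * ((u * (1 + u) : ℝ) : ℂ) ^ ℓ := by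
  have h1 : (u : ℂ) ≠ 0 := by exact_mod_cast hu.ne'
  have h2 : ((1 + u : ℝ) : ℂ) ≠ 0 := by exact_mod_cast (by positivity : 1 + u ≠ 0)
  rw [powerKernel, powerKernel, show a + ℓ - 1 = a - 1 + ℓ by ring, Complex.cpow_add _ _ h1,
    Complex.cpow_add _ _ h2, Complex.cpow_natCast, Complex.cpow_natCast, Complex.ofReal_mul, mul_pow]
  ring

theorem hasSum_integral_legendreP_mul_besselIntegrand {x : ℝ} (hx : ∀ ℓ, |legendreP ℓ x| ≤ 1)
    {a : ℂ} (b : ℂ) (ha : 0 < a.re) {s p : ℝ} (hp : 0 ≤ p) (hs : 2 * √p < s) :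
    HasSum (fun ℓ : ℕ => ((2 * ℓ + 1) * legendreP ℓ x : ℝ) * (p : ℂ) ^ ℓ *
        ∫ u in Set.Ioi (0 : ℝ), besselIntegrand (a + ℓ) (b + ℓ) (2 * ℓ + 1) s p u)
      (∫ u in Set.Ioi (0 : ℝ), besselIntegrand a b 0 s (p * ((1 + x) / 2 : ℝ)) u) := by
  have h0 : ∀ u : ℝ, 0 < u → (p : ℂ) * (u * (1 + u)) = ((p * (u * (1 + u)) : ℝ) : ℂ) := by
    intro u _; push_cast; ring
  have hterm : ∀ (ℓ : ℕ) (u : ℝ), 0 < u →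
      ((2 * ℓ + 1) * legendreP ℓ x : ℝ) * (p : ℂ) ^ ℓ *
        besselIntegrand (a + ℓ) (b + ℓ) (2 * ℓ + 1) s p u =
      powerKernel a b u * Complex.exp (-s * u) * ((((2 * ℓ + 1) * legendreP ℓ x : ℝ) : ℂ) *
        (((p * (u * (1 + u)) : ℝ) : ℂ) ^ ℓ *
          besselB (2 * ℓ + 1) ((p * (u * (1 + u)) : ℝ) : ℂ))) := by
    intro ℓ u hu
    rw [besselIntegrand, powerKernel_add_natCast a b ℓ hu, h0 u hu,
      Complex.ofReal_mul p (u * (1 + u)), mul_pow]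
    ring
  have hdom : ∀ u : ℝ, 0 < u → HasSum (fun ℓ : ℕ => ‖powerKernel a b u * Complex.exp (-s * u)‖ *
      ((2 * ℓ + 1 : ℝ) * ((p * (u * (1 + u))) ^ ℓ *
        ‖besselB (2 * ℓ + 1) ((p * (u * (1 + u)) : ℝ) : ℂ)‖)))
      ‖besselIntegrand a b 0 s p u‖ := by
    intro u hu
    have := (hasSum_norm_besselB (ρ := p * (u * (1 + u))) (by positivity)).mul_left
      ‖powerKernel a b u * Complex.exp (-s * u)‖
    rw [besselIntegrand, ← mul_assoc (powerKernel a b u), norm_mul _ (besselB _ _), h0 u hu]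
    exact this
  simp_rw [← integral_const_mul]
  refine hasSum_integral_of_dominated_convergence (fun (ℓ : ℕ) (u : ℝ) =>
    ‖powerKernel a b u * Complex.exp (-s * u)‖ *
      ((2 * ℓ + 1 : ℝ) * ((p * (u * (1 + u))) ^ ℓ *
        ‖besselB (2 * ℓ + 1) ((p * (u * (1 + u)) : ℝ) : ℂ)‖))) ?_ ?_ ?_ ?_ ?_
  · exact fun ℓ => (aestronglyMeasurable_besselIntegrand _ _ _ _ _).const_mul _
  · refine fun ℓ => (ae_restrict_mem measurableSet_Ioi).mono fun u hu => ?_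
    have hu : 0 < u := hu
    rw [hterm ℓ u hu, norm_mul, norm_mul (_ : ℂ) (_ * _), norm_mul (_ ^ ℓ), norm_pow,
      Complex.norm_real, Complex.norm_real, Real.norm_of_nonneg (by positivity : 0 ≤ p * (u * (1 + u))),
      Real.norm_eq_abs, abs_mul, abs_of_nonneg (by positivity : (0 : ℝ) ≤ 2 * ℓ + 1)]
    have := hx ℓ
    gcongr
    nlinarith [(by positivity : (0 : ℝ) ≤ 2 * ℓ + 1)]
  · exact (ae_restrict_mem measurableSet_Ioi).mono fun u hu => (hdom u hu).summable
  · have hi : Integrable (fun u => ‖besselIntegrand a b 0 s p u‖)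
        (volume.restrict (Set.Ioi (0 : ℝ))) :=
      (integrableOn_besselIntegrand b 0 ha (by simpa [abs_of_nonneg hp] using hs)).norm
    refine hi.congr ((ae_restrict_mem measurableSet_Ioi).mono fun u hu => ?_)
    exact (hdom u hu).tsum_eq.symm
  · refine (ae_restrict_mem measurableSet_Ioi).mono fun u hu => ?_
    have hu : 0 < u := hu
    have := (hasSum_legendreP_mul_besselB hx ((p * (u * (1 + u)) : ℝ) : ℂ)).mul_left
      (powerKernel a b u * Complex.exp (-s * u))
    have he : besselIntegrand a b 0 s (p * ((1 + x) / 2 : ℝ)) u =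
        powerKernel a b u * Complex.exp (-s * u) *
          besselB 0 (((p * (u * (1 + u)) : ℝ) : ℂ) * ((1 + x) / 2 : ℝ)) := by
      rw [besselIntegrand, ← mul_assoc, ← h0 u hu, mul_right_comm (p : ℂ)]
    rw [he]
    exact this.congr_fun fun ℓ => hterm ℓ u hu

theorem whittakerW_eq_integral_powerKernel (κ : ℂ) {μ : ℂ} (ℓ : ℕ) (hμ : μ = ℓ + 1 / 2) {X : ℝ}
    (hX : 0 < X) :
    whittakerW κ μ X = Complex.exp (-(X : ℂ) / 2) * (X : ℂ) ^ (ℓ + 1) *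
      (Complex.Gamma (ℓ + 1 - κ))⁻¹ *
      ∫ u in Set.Ioi (0 : ℝ), powerKernel (ℓ + 1 - κ) (ℓ + κ) u * Complex.exp (-X * u) := by
  have hX0 : (X : ℂ) ≠ 0 := by exact_mod_cast hX.ne'
  have h := integral_comp_mul_left_Ioi (fun t : ℝ => (t : ℂ) ^ (μ - κ - 1 / 2) *
    ((1 + t / X : ℝ) : ℂ) ^ (μ + κ - 1 / 2) * Complex.exp (-(t : ℂ))) 0 hX
  rw [mul_zero] at h
  have h2 : ∫ u in Set.Ioi (0 : ℝ), ((X * u : ℝ) : ℂ) ^ (μ - κ - 1 / 2) *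
      ((1 + (X * u) / X : ℝ) : ℂ) ^ (μ + κ - 1 / 2) * Complex.exp (-((X * u : ℝ) : ℂ)) =
      (X : ℂ) ^ (ℓ - κ) * ∫ u in Set.Ioi (0 : ℝ),
        powerKernel (ℓ + 1 - κ) (ℓ + κ) u * Complex.exp (-X * u) := by
    rw [← integral_const_mul]
    refine setIntegral_congr_fun measurableSet_Ioi fun u hu => ?_
    have hu : 0 < u := hu
    rw [mul_div_cancel_left₀ _ hX.ne', powerKernel, show μ - κ - 1 / 2 = ℓ - κ by rw [hμ]; ring,
      show μ + κ - 1 / 2 = ℓ + κ by rw [hμ]; ring, show (ℓ : ℂ) + 1 - κ - 1 = ℓ - κ by ring,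
      Complex.ofReal_mul, Complex.mul_cpow_ofReal_nonneg hX.le hu.le, neg_mul]
    ring
  rw [h2] at h
  have h3 : ∫ t in Set.Ioi (0 : ℝ), (t : ℂ) ^ (μ - κ - 1 / 2) *
      ((1 + t / X : ℝ) : ℂ) ^ (μ + κ - 1 / 2) * Complex.exp (-(t : ℂ)) =
      X * ((X : ℂ) ^ (ℓ - κ) * ∫ u in Set.Ioi (0 : ℝ),
        powerKernel (ℓ + 1 - κ) (ℓ + κ) u * Complex.exp (-X * u)) := by
    rw [h, Complex.real_smul, Complex.ofReal_inv, mul_inv_cancel_left₀ hX0]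
  rw [whittakerW, h3, show μ - κ + 1 / 2 = ℓ + 1 - κ by rw [hμ]; ring]
  have h4 : (X : ℂ) ^ κ * (X * (X : ℂ) ^ (ℓ - κ)) = (X : ℂ) ^ (ℓ + 1) := by
    rw [← Complex.cpow_natCast, show ((ℓ + 1 : ℕ) : ℂ) = κ + 1 + (ℓ - κ) by push_cast; ring,
      Complex.cpow_add _ _ hX0, Complex.cpow_add _ _ hX0, Complex.cpow_one]
    ring
  rw [← h4]
  ring

theorem whittakerM_eq_kummerPhi (κ : ℂ) (ℓ : ℕ) (z : ℂ) :
    whittakerM κ ℓ z = Complex.exp (-z / 2) * z ^ (ℓ + 1) *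
      kummerPhi (ℓ + 1 - κ) (((2 * ℓ + 1 : ℕ) : ℂ) + 1) z := by
  rw [whittakerM, kummerPhi, show (((2 * ℓ + 1 : ℕ) : ℂ) + 1) = 2 * ℓ + 2 by push_cast; ring]

theorem differentiable_whittakerM (κ : ℂ) (ℓ : ℕ) : Differentiable ℂ (whittakerM κ ℓ) := by
  have h := differentiable_kummerPhi (ℓ + 1 - κ) (2 * ℓ + 1)
  rw [funext (whittakerM_eq_kummerPhi κ ℓ)]
  fun_prop

theorem whittakerM_mul_whittakerW {κ : ℂ} (hκ : κ.re < 1) {μ : ℂ} (ℓ : ℕ) (hμ : μ = ℓ + 1 / 2)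
    {X : ℝ} (hX : 0 < X) {Y : ℂ} (hY : Y ∈ kummerRegion X) :
    whittakerM κ ℓ Y * whittakerW κ μ X =
      (X * Y) ^ (ℓ + 1) * Complex.exp (-(X + Y) / 2) * (Complex.Gamma (ℓ + 1 - κ))⁻¹ *
        ((2 * ℓ + 1).factorial : ℂ) *
        ∫ u in Set.Ioi (0 : ℝ),
          besselIntegrand (ℓ + 1 - κ) (ℓ + κ) (2 * ℓ + 1) (X + Y) (X * Y) u := by
  have ha : 0 < ((ℓ : ℂ) + 1 - κ).re := by
    have : (0 : ℝ) ≤ ℓ := by positivity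
    simp; linarith
  have h := integral_kummerIntegrand (2 * ℓ + 1) hX ha hY
  rw [show ((2 * ℓ + 1 : ℕ) : ℂ) - (ℓ + 1 - κ) = ℓ + κ by push_cast; ring] at h
  rw [h, whittakerM_eq_kummerPhi, whittakerW_eq_integral_powerKernel κ ℓ hμ hX,
    show -((X : ℂ) + Y) / 2 = -X / 2 + -Y / 2 by ring, Complex.exp_add, mul_pow]
  have hf : ((2 * ℓ + 1).factorial : ℂ) ≠ 0 := by exact_mod_cast Nat.factorial_ne_zero _
  field_simp

theorem differentiableAt_integral_powerKernel {a : ℂ} (b : ℂ) (ha : 0 < a.re) {X : ℝ} (hX : 0 < X) :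
    DifferentiableAt ℂ (fun z : ℂ => ∫ u in Set.Ioi (0 : ℝ),
      powerKernel a b u * Complex.exp (-z * u)) X := by
  have hm : ∀ z : ℂ, AEStronglyMeasurable (fun u : ℝ => powerKernel a b u * Complex.exp (-z * u))
      (volume.restrict (Set.Ioi 0)) := fun z =>
    ((continuousOn_powerKernel a b).mul (by fun_prop)).aestronglyMeasurable measurableSet_Ioi
  refine (hasDerivAt_integral_of_dominated_holomorphic
    (f' := fun z u => powerKernel a b u * (Complex.exp (-z * u) * -u))
    (g := fun u => ‖powerKernel a b u‖ * Real.exp (-(X / 2) * u)) (ε := X / 4)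
    (by positivity) (fun z _ => hm z) ?_ ?_ ?_ ?_).2.2.differentiableAt
  · exact ((continuousOn_powerKernel a b).mul (by fun_prop)).aestronglyMeasurable measurableSet_Ioi
  · refine Filter.Eventually.of_forall fun u z _ => ?_
    exact ((((hasDerivAt_id z).neg.mul_const (u : ℂ)).cexp).const_mul _).congr_deriv (by simp)
  · refine (ae_restrict_mem measurableSet_Ioi).mono fun u hu z hz => ?_
    have hu : 0 < u := hu
    rw [norm_mul, Complex.norm_exp]
    have h1 : |(z - X).re| ≤ ‖z - X‖ := Complex.abs_re_le_norm _
    have h2 : ‖z - X‖ < 2 * (X / 4) := by simpa [dist_eq_norm] using hz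
    have h3 : X / 2 ≤ z.re := by
      have := neg_abs_le (z - X).re
      simp only [Complex.sub_re, Complex.ofReal_re] at *
      linarith
    gcongr
    simp only [Complex.mul_re, Complex.neg_re, Complex.ofReal_re, Complex.ofReal_im, mul_zero,
      sub_zero]
    nlinarith
  · exact integrableOn_norm_powerKernel_mul_exp b ha (by positivity)

theorem differentiableAt_whittakerW {κ : ℂ} (hκ : κ.re < 1) {X : ℝ} (hX : 0 < X) :
    DifferentiableAt ℝ (whittakerW κ (1 / 2)) X := by
  have ha : 0 < ((0 : ℕ) + 1 - κ : ℂ).re := by simpa using hκ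
  have h := differentiableAt_integral_powerKernel ((0 : ℕ) + κ) ha hX
  have h1 : DifferentiableAt ℂ (fun z : ℂ => Complex.exp (-z / 2) * z ^ (0 + 1) *
      (Complex.Gamma ((0 : ℕ) + 1 - κ))⁻¹ * ∫ u in Set.Ioi (0 : ℝ),
      powerKernel ((0 : ℕ) + 1 - κ) ((0 : ℕ) + κ) u * Complex.exp (-z * u)) X :=
    (by fun_prop : DifferentiableAt ℂ (fun z : ℂ => Complex.exp (-z / 2) * z ^ (0 + 1) *
      (Complex.Gamma ((0 : ℕ) + 1 - κ))⁻¹) X).mul h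
  refine h1.hasDerivAt.comp_ofReal.differentiableAt.congr_of_eventuallyEq ?_
  filter_upwards [lt_mem_nhds hX] with Z hZ
  exact whittakerW_eq_integral_powerKernel κ 0 (by simp) hZ

theorem hasDerivAt_mul_integral_besselIntegrand {a : ℂ} (b : ℂ) (ha : 0 < a.re) {s : ℝ} {p : ℂ}
    (h : 2 * √‖p‖ < s) :
    HasDerivAt (fun z : ℂ => z * ∫ u in Set.Ioi (0 : ℝ), besselIntegrand a b 1 s z u)
      (∫ u in Set.Ioi (0 : ℝ), besselIntegrand a b 0 s p u) p := by
  obtain ⟨A, hpA, hAs⟩ : ∃ A, √‖p‖ < A ∧ 2 * A < s := ⟨(√‖p‖ + s / 2) / 2, by linarith, by linarith⟩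
  have hA0 : 0 < A := (Real.sqrt_nonneg _).trans_lt hpA
  have hA : ‖p‖ < A ^ 2 := (Real.sqrt_lt' hA0).mp hpA
  simp_rw [← integral_const_mul]
  refine (hasDerivAt_integral_of_dominated_holomorphic (ε := (A ^ 2 - ‖p‖) / 2)
    (f := fun z u => z * besselIntegrand a b 1 s z u)
    (f' := fun z u => besselIntegrand a b 0 s z u)
    (g := fun u => A ^ 2 * (Real.exp A * (‖powerKernel a b u‖ * Real.exp (-(s - 2 * A) * u))))
    (by linarith) (fun z _ => (aestronglyMeasurable_besselIntegrand _ _ _ _ _).const_mul _)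
    (aestronglyMeasurable_besselIntegrand _ _ _ _ _) ?_ ?_ ?_).2.2
  · refine Filter.Eventually.of_forall fun u z _ => ?_
    have h1 := (hasDerivAt_besselB 1 (z * (u * (1 + u)))).comp z
      ((hasDerivAt_id z).mul_const ((u : ℂ) * (1 + u)))
    have h2 := ((hasDerivAt_id z).mul h1).const_mul (powerKernel a b u * Complex.exp (-s * u))
    have h3 := besselB_recurrence 0 (z * (u * (1 + u)))
    refine (h2.congr_of_eventuallyEq (Filter.Eventually.of_forall fun z => ?_)).congr_deriv ?_
    · simp only [besselIntegrand, Pi.mul_apply, Function.comp_apply, id_eq]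
      ring
    · simp only [besselIntegrand, Function.comp_apply, id_eq]
      push_cast at h3
      linear_combination powerKernel a b u * Complex.exp (-s * u) * h3
  · refine (ae_restrict_mem measurableSet_Ioi).mono fun u hu z hz => ?_
    have hz : ‖z‖ ≤ A ^ 2 := by
      have h1 : ‖z - p‖ < 2 * ((A ^ 2 - ‖p‖) / 2) := by simpa [dist_eq_norm] using hz
      have h2 := norm_le_norm_add_norm_sub' z p
      linarith
    have hzA : √‖z‖ ≤ A := Real.sqrt_le_iff.mpr ⟨hA0.le, hz⟩
    rw [norm_mul]
    have := norm_besselIntegrand_le a b 1 (s := (s : ℂ)) (p := z) (σ := s - 2 * A) hzA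
      (by rw [Complex.ofReal_re]; linarith) hu
    gcongr
  · exact ((integrableOn_norm_powerKernel_mul_exp b ha (by linarith)).const_mul _).const_mul _

theorem deriv_whittaker_sub {κ : ℂ} (hκ : κ.re < 1) {X Y : ℝ} (hY : 0 ≤ Y) (hYX : Y < X) :
    deriv (whittakerM κ 0) (Y : ℂ) * whittakerW κ (1 / 2) X -
        whittakerM κ 0 (Y : ℂ) * deriv (whittakerW κ (1 / 2)) X =
      (X - Y) * ((Complex.Gamma (1 - κ))⁻¹ * Complex.exp (-(X + Y) / 2) *
        ∫ u in Set.Ioi (0 : ℝ), besselIntegrand (1 - κ) κ 0 (X + Y) (X * Y) u) := by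
  have hX : 0 < X := hY.trans_lt hYX
  have ha : 0 < (1 - κ).re := by simpa using hκ
  have hM : HasDerivAt (fun θ : ℝ => whittakerM κ 0 ((Y : ℂ) + θ)) (deriv (whittakerM κ 0) Y) 0 := by
    have h1 : HasDerivAt (whittakerM κ 0) (deriv (whittakerM κ 0) Y) ((Y : ℂ) + (0 : ℝ)) := by
      rw [Complex.ofReal_zero, add_zero]
      exact (differentiable_whittakerM κ 0 _).hasDerivAt
    have h2 : HasDerivAt (fun θ : ℝ => (Y : ℂ) + θ) 1 0 :=
      (Complex.ofRealCLM.hasDerivAt (x := (0 : ℝ))).const_add _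
    exact (h1.comp (0 : ℝ) h2).congr_deriv (mul_one _)
  have hW : HasDerivAt (fun θ : ℝ => whittakerW κ (1 / 2) (X - θ))
      (-deriv (whittakerW κ (1 / 2)) X) 0 := by
    have h1 : HasDerivAt (whittakerW κ (1 / 2)) (deriv (whittakerW κ (1 / 2)) X) (X - 0) := by
      rw [sub_zero]
      exact (differentiableAt_whittakerW hκ hX).hasDerivAt
    have h2 : HasDerivAt (fun θ : ℝ => X - θ) (-1) 0 := (hasDerivAt_id _).const_sub _
    exact (h1.scomp (0 : ℝ) h2).congr_deriv (by simp)
  have hp : HasDerivAt (fun θ : ℝ => (((X - θ) * (Y + θ) : ℝ) : ℂ)) ((X : ℂ) - Y) 0 := by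
    have h1 : HasDerivAt (fun θ : ℝ => (X - θ) * (Y + θ)) (X - Y) 0 :=
      (((hasDerivAt_id (0 : ℝ)).const_sub X).mul ((hasDerivAt_id (0 : ℝ)).const_add Y)).congr_deriv
        (by simp; ring)
    exact h1.ofReal_comp.congr_deriv (by push_cast; rfl)
  have hs : 2 * √‖((X * Y : ℝ) : ℂ)‖ < X + Y := by
    have := (ofReal_mem_kummerRegion hY hYX).1
    rw [Complex.ofReal_re] at this
    push_cast
    linarith
  have hI := hasDerivAt_mul_integral_besselIntegrand κ ha hs
  have hG : HasDerivAt (fun θ : ℝ => (fun z : ℂ => z * ∫ u in Set.Ioi (0 : ℝ),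
      besselIntegrand (1 - κ) κ 1 ((X + Y : ℝ) : ℂ) z u) (((X - θ) * (Y + θ) : ℝ) : ℂ))
      ((∫ u in Set.Ioi (0 : ℝ), besselIntegrand (1 - κ) κ 0 ((X + Y : ℝ) : ℂ) ((X * Y : ℝ) : ℂ) u) *
        ((X : ℂ) - Y)) 0 := by
    exact hI.comp_of_eq (0 : ℝ) hp (by simp)
  have hmem : ∀ᶠ θ : ℝ in nhds 0, 0 < X - θ ∧ (Y : ℂ) + θ ∈ kummerRegion (X - θ) := by
    have h0 := ofReal_mem_kummerRegion hY hYX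
    have c1 : Continuous fun θ : ℝ => X - θ := by fun_prop
    have c2 : Continuous fun θ : ℝ => 2 * √‖((X - θ : ℝ) : ℂ) * ((Y : ℂ) + θ)‖ - ((Y : ℂ) + θ).re := by
      fun_prop
    have c3 : Continuous fun θ : ℝ => ‖(Y : ℂ) + θ‖ := by fun_prop
    refine (c1.continuousAt.eventually (lt_mem_nhds (by simpa using hX))).and
      ((c2.continuousAt.eventually_lt c1.continuousAt ?_).and
        (c3.continuousAt.eventually_lt c1.continuousAt ?_))
    · simpa using h0.1
    · simpa using h0.2
  have hF := hM.mul hW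
  have hF' : HasDerivAt (fun θ : ℝ => whittakerM κ 0 ((Y : ℂ) + θ) * whittakerW κ (1 / 2) (X - θ)) _ 0 :=
    (hG.const_mul ((Complex.Gamma (1 - κ))⁻¹ * Complex.exp (-(X + Y) / 2))).congr_of_eventuallyEq
    (hmem.mono fun θ hθ => by
      have h := whittakerM_mul_whittakerW hκ 0 (μ := 1 / 2) (by simp) hθ.1 hθ.2
      have e1 : ((X - θ : ℝ) : ℂ) + ((Y : ℂ) + θ) = ((X + Y : ℝ) : ℂ) := by push_cast; ring
      have e2 : ((X - θ : ℝ) : ℂ) * ((Y : ℂ) + θ) = (((X - θ) * (Y + θ) : ℝ) : ℂ) := by push_cast; ring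
      rw [e1, e2] at h
      simp only [h, Nat.cast_zero, zero_add, mul_zero, pow_one, Nat.factorial_one, Nat.cast_one,
        mul_one]
      push_cast
      ring)
  have := hF.unique hF'
  simp only [Complex.ofReal_zero, add_zero, sub_zero] at this
  push_cast at this
  linear_combination this

/-- The addition formula for the Whittaker functions. -/
theorem whittaker_addition_formula (κ : ℂ) (hκ : κ.re < 1) (r₀ r γ : ℝ)
    (hr₀ : 0 < r₀) (hr : r₀ < r) (R x y : ℝ)
    (hR : R = Real.sqrt (r ^ 2 + r₀ ^ 2 - 2 * r * r₀ * Real.cos γ))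
    (hx : x = r + r₀ + R) (hy : y = r + r₀ - R) :
    HasSum
      (fun ℓ : ℕ =>
        (1 / (r * r₀ : ℂ)) *
          (Complex.Gamma ((ℓ : ℂ) + 1 - κ) /
            (Complex.Gamma (1 - κ) * ((2 * ℓ).factorial : ℂ))) *
          whittakerM κ ℓ (r₀ : ℂ) * whittakerW κ ((ℓ : ℂ) + 1 / 2) r *
          (legendreP ℓ (Real.cos γ) : ℂ))
      ((1 / (R : ℂ)) *
        (deriv (whittakerM κ 0) ((y / 2 : ℝ) : ℂ) * whittakerW κ (1 / 2) (x / 2) -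
          whittakerM κ 0 ((y / 2 : ℝ) : ℂ) * deriv (whittakerW κ (1 / 2)) (x / 2))) := by
  have hr' : 0 < r := hr₀.trans hr
  have hrr : 0 < r * r₀ := mul_pos hr' hr₀
  have hcos := Real.cos_le_one γ
  have hcos' := Real.neg_one_le_cos γ
  have hsq : 0 < r ^ 2 + r₀ ^ 2 - 2 * r * r₀ * Real.cos γ := by nlinarith
  have hR0 : 0 < R := hR ▸ Real.sqrt_pos.mpr hsq
  have hR2 : R ^ 2 = r ^ 2 + r₀ ^ 2 - 2 * r * r₀ * Real.cos γ := hR ▸ Real.sq_sqrt hsq.le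
  have hy0 : 0 ≤ y / 2 := by
    have : R ≤ r + r₀ := abs_le_of_sq_le_sq' (by nlinarith) (by positivity) |>.2
    linarith
  have hs : 2 * √(r * r₀) < r + r₀ := by
    have h1 : √(r * r₀) < (r + r₀) / 2 := (Real.sqrt_lt' (by positivity)).mpr (by nlinarith)
    linarith
  have hxy : (x / 2) * (y / 2) = r * r₀ * ((1 + Real.cos γ) / 2) := by
    rw [hx, hy]; linear_combination -hR2 / 4
  rw [deriv_whittaker_sub hκ hy0 (by linarith : y / 2 < x / 2)]
  have hsum := (hasSum_integral_legendreP_mul_besselIntegrand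
    (fun ℓ => abs_legendreP_cos_le_one ℓ γ) (a := 1 - κ) κ (by simpa using hκ) hrr.le hs).mul_left
    ((Complex.Gamma (1 - κ))⁻¹ * Complex.exp (-((r + r₀ : ℝ) : ℂ) / 2))
  have hRc : (R : ℂ) ≠ 0 := by exact_mod_cast hR0.ne'
  have hrc : (r : ℂ) ≠ 0 := by exact_mod_cast hr'.ne'
  have hrc₀ : (r₀ : ℂ) ≠ 0 := by exact_mod_cast hr₀.ne'
  have e1 : ((x / 2 : ℝ) : ℂ) + ((y / 2 : ℝ) : ℂ) = ((r + r₀ : ℝ) : ℂ) := by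
    rw [← Complex.ofReal_add]; congr 1; linarith
  have e2 : ((x / 2 : ℝ) : ℂ) * ((y / 2 : ℝ) : ℂ) =
      ((r * r₀ : ℝ) : ℂ) * (((1 + Real.cos γ) / 2 : ℝ) : ℂ) := by
    rw [← Complex.ofReal_mul, ← Complex.ofReal_mul, hxy]
  have e3 : ((x / 2 : ℝ) : ℂ) - ((y / 2 : ℝ) : ℂ) = R := by
    rw [← Complex.ofReal_sub]; congr 1; linarith
  rw [e1, e2, e3, ← mul_assoc (1 / (R : ℂ)), one_div_mul_cancel hRc, one_mul]
  refine hsum.congr_fun fun ℓ => ?_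
  have ha : 0 < ((ℓ : ℂ) + 1 - κ).re := by
    have : (0 : ℝ) ≤ ℓ := by positivity
    simp; linarith
  have hprod := whittakerM_mul_whittakerW hκ ℓ rfl hr' (ofReal_mem_kummerRegion hr₀.le hr)
  have hG : Complex.Gamma (ℓ + 1 - κ) ≠ 0 := Complex.Gamma_ne_zero_of_re_pos ha
  have hG1 : Complex.Gamma (1 - κ) ≠ 0 := Complex.Gamma_ne_zero_of_re_pos (by simpa using hκ)
  have hf : ((2 * ℓ).factorial : ℂ) ≠ 0 := by exact_mod_cast Nat.factorial_ne_zero _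
  rw [mul_assoc _ (whittakerM κ ℓ r₀), hprod, ← Complex.ofReal_mul, ← Complex.ofReal_add,
    show (1 : ℂ) - κ + ℓ = ℓ + 1 - κ by ring, add_comm κ, Nat.factorial_succ, pow_succ]
  push_cast
  field_simp
end
end

section
/- Let κ ∈ ℂ with Re(κ) < 1 and let 0 < r₀ < r be real numbers. Then the series (1/(r r₀)) Σ_{ℓ=0}^∞ (−1)^ℓ (Γ(ℓ+1−κ)/(2ℓ)!) · M_{κ,ℓ+1/2}(r₀) · W_{κ,ℓ+1/2}(r) converges, and its sum equals (Γ(1−κ)/(r+r₀)) · W_{κ,1/2}(r+r₀). -/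
open scoped BigOperators
open MeasureTheory

noncomputable section

/-- The kernel `s^{a+k-κ} (1+s)^{a+κ} e^{-cs}`. -/
def whittakerKernel (κ : ℂ) (c : ℝ) (a k : ℕ) (s : ℝ) : ℂ :=
  (s : ℂ) ^ ((a : ℂ) + k - κ) * ((1 + s : ℝ) : ℂ) ^ ((a : ℂ) + κ) * Complex.exp (-((c * s : ℝ) : ℂ))

/-- The Laplace-type integral of `whittakerKernel` over `(0, ∞)`. -/
def whittakerIntegral (κ : ℂ) (c : ℝ) (a k : ℕ) : ℂ :=
  ∫ s in Set.Ioi (0 : ℝ), whittakerKernel κ c a k s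

lemma norm_whittakerKernel (κ : ℂ) (c : ℝ) (a k : ℕ) {s : ℝ} (hs : 0 < s) :
    ‖whittakerKernel κ c a k s‖ =
      s ^ ((a : ℝ) + k - κ.re) * (1 + s) ^ ((a : ℝ) + κ.re) * Real.exp (-(c * s)) := by
  have h1 : (0 : ℝ) < 1 + s := by linarith
  rw [whittakerKernel, norm_mul, norm_mul, Complex.norm_cpow_eq_rpow_re_of_pos hs,
    Complex.norm_cpow_eq_rpow_re_of_pos h1, Complex.norm_exp]
  simp

lemma whittakerKernel_eq_mul (κ : ℂ) (c d : ℝ) (a k : ℕ) {s : ℝ} (hs : 0 < s) :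
    whittakerKernel κ (c + d) a k s =
      (s : ℂ) ^ k * ((s : ℂ) * (1 + s)) ^ a * Complex.exp (-((d * s : ℝ) : ℂ)) *
        whittakerKernel κ c 0 0 s := by
  have hs' : (s : ℂ) ≠ 0 := by exact_mod_cast hs.ne'
  have h1 : ((1 + s : ℝ) : ℂ) ≠ 0 := by exact_mod_cast (by linarith : (0 : ℝ) < 1 + s).ne'
  have e1 : (a : ℂ) + k - κ = ((a + k : ℕ) : ℂ) + (((0 : ℕ) : ℂ) + ((0 : ℕ) : ℂ) - κ) := by
    push_cast; ring
  have e2 : (a : ℂ) + κ = (a : ℂ) + (((0 : ℕ) : ℂ) + κ) := by push_cast; ring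
  have e3 : -(((c + d) * s : ℝ) : ℂ) = -((d * s : ℝ) : ℂ) + -((c * s : ℝ) : ℂ) := by
    push_cast; ring
  rw [whittakerKernel, whittakerKernel, e1, e2, e3, Complex.cpow_add _ _ hs',
    Complex.cpow_add _ _ h1, Complex.cpow_natCast, Complex.cpow_natCast, Complex.exp_add,
    mul_pow, pow_add]
  push_cast
  ring

lemma continuousOn_whittakerKernel (κ : ℂ) (c : ℝ) (a k : ℕ) :
    ContinuousOn (whittakerKernel κ c a k) (Set.Ioi 0) := by
  intro s hs
  have hs : 0 < s := hs
  have h1 : 0 < 1 + s := by linarith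
  apply ContinuousAt.continuousWithinAt
  unfold whittakerKernel
  refine ((ContinuousAt.cpow (by fun_prop) continuousAt_const ?_).mul
    (ContinuousAt.cpow (by fun_prop) continuousAt_const ?_)).mul (by fun_prop)
  · exact Complex.ofReal_mem_slitPlane.2 hs
  · exact Complex.ofReal_mem_slitPlane.2 h1

lemma integrableOn_whittakerKernel {κ : ℂ} (hκ : κ.re < 1) {c : ℝ} (hc : 0 < c) (a k : ℕ) :
    IntegrableOn (whittakerKernel κ c a k) (Set.Ioi 0) := by
  set M : ℕ := a + ⌈|κ.re|⌉₊ with hM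
  have hM' : (a : ℝ) + κ.re ≤ M := by
    rw [hM]; push_cast
    linarith [Nat.le_ceil |κ.re|, le_abs_self κ.re]
  have hp : -1 < (a : ℝ) + k - κ.re := by
    have : (0 : ℝ) ≤ a := a.cast_nonneg
    have : (0 : ℝ) ≤ k := k.cast_nonneg
    linarith
  have hint := (integrableOn_rpow_mul_exp_neg_mul_rpow hp one_pos (half_pos hc)).const_mul
    ((M.factorial : ℝ) * (2 / c) ^ M * Real.exp (c / 2))
  refine hint.mono' ((continuousOn_whittakerKernel κ c a k).aestronglyMeasurable
    measurableSet_Ioi) ?_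
  refine (ae_restrict_iff' measurableSet_Ioi).2 (.of_forall fun s hs => ?_)
  have hs : 0 < s := hs
  rw [norm_whittakerKernel κ c a k hs, Real.rpow_one]
  have h1 : (1 + s) ^ ((a : ℝ) + κ.re) ≤ (1 + s) ^ M := by
    rw [← Real.rpow_natCast]
    exact Real.rpow_le_rpow_of_exponent_le (by linarith) hM'
  have h2 : (1 + s) ^ M ≤
      (M.factorial : ℝ) * (2 / c) ^ M * Real.exp (c / 2 * (1 + s)) := by
    have := Real.pow_div_factorial_le_exp (c / 2 * (1 + s)) (by positivity) M
    rw [div_le_iff₀ (by positivity)] at this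
    calc (1 + s) ^ M = (2 / c) ^ M * (c / 2 * (1 + s)) ^ M := by
          rw [← mul_pow]; congr 1; field_simp
      _ ≤ (2 / c) ^ M * (Real.exp (c / 2 * (1 + s)) * M.factorial) := by gcongr
      _ = _ := by ring
  have h3 : Real.exp (c / 2 * (1 + s)) * Real.exp (-(c * s)) =
      Real.exp (c / 2) * Real.exp (-(c / 2) * s) := by
    rw [← Real.exp_add, ← Real.exp_add]; congr 1; ring
  calc s ^ ((a : ℝ) + k - κ.re) * (1 + s) ^ ((a : ℝ) + κ.re) * Real.exp (-(c * s))
      ≤ s ^ ((a : ℝ) + k - κ.re) *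
        ((M.factorial : ℝ) * (2 / c) ^ M * Real.exp (c / 2 * (1 + s))) *
          Real.exp (-(c * s)) := by
        gcongr
        exact h1.trans h2
    _ = (M.factorial : ℝ) * (2 / c) ^ M * s ^ ((a : ℝ) + k - κ.re) *
        (Real.exp (c / 2 * (1 + s)) * Real.exp (-(c * s))) := by ring
    _ = _ := by rw [h3]; ring

/-- Integration by parts, lowering the exponents of the kernel. -/
lemma mul_whittakerIntegral_succ {κ : ℂ} (hκ : κ.re < 1) {c : ℝ} (hc : 0 < c) (a k : ℕ) :
    c * whittakerIntegral κ c (a + 1) k =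
      ((a : ℂ) + k + 1 - κ) * whittakerIntegral κ c a k +
        (2 * (a : ℂ) + 2 + k) * whittakerIntegral κ c a (k + 1) := by
  have hpos : ∀ n : ℕ, (0 : ℝ) ≤ n := fun n => n.cast_nonneg
  have hre : 0 < (((a + 1 : ℕ) : ℂ) + k - κ).re := by
    simp; linarith [hpos a, hpos k]
  have hne : ((a + 1 : ℕ) : ℂ) + k - κ ≠ 0 := fun h => by rw [h] at hre; exact lt_irrefl 0 hre
  set F' : ℝ → ℂ := fun s => ((a : ℂ) + k + 1 - κ) * whittakerKernel κ c a k s +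
    (2 * (a : ℂ) + 2 + k) * whittakerKernel κ c a (k + 1) s -
      c * whittakerKernel κ c (a + 1) k s with hF'
  have hI := integrableOn_whittakerKernel hκ hc
  have hI1 : IntegrableOn (fun s => ((a : ℂ) + k + 1 - κ) * whittakerKernel κ c a k s)
    (Set.Ioi 0) := (hI a k).const_mul _
  have hI2 : IntegrableOn (fun s => (2 * (a : ℂ) + 2 + k) * whittakerKernel κ c a (k + 1) s)
    (Set.Ioi 0) := (hI a (k + 1)).const_mul _
  have hI3 : IntegrableOn (fun s => (c : ℂ) * whittakerKernel κ c (a + 1) k s)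
    (Set.Ioi 0) := (hI (a + 1) k).const_mul _
  have hI12 : IntegrableOn (fun s => ((a : ℂ) + k + 1 - κ) * whittakerKernel κ c a k s +
    (2 * (a : ℂ) + 2 + k) * whittakerKernel κ c a (k + 1) s) (Set.Ioi 0) := hI1.add hI2
  have hint : IntegrableOn F' (Set.Ioi 0) := hI12.sub hI3
  have hderiv : ∀ s ∈ Set.Ioi (0 : ℝ), HasDerivAt (whittakerKernel κ c (a + 1) k) (F' s) s := by
    intro s hs
    have hs : 0 < s := hs
    have h1 : (0 : ℝ) < 1 + s := by linarith
    have hs' : (s : ℂ) ≠ 0 := by exact_mod_cast hs.ne'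
    have h1' : (1 + s : ℂ) ≠ 0 := by exact_mod_cast h1.ne'
    have d1 := hasDerivAt_ofReal_cpow_const hs.ne' hne
    have d2 : HasDerivAt (fun s : ℝ => ((1 + s : ℝ) : ℂ) ^ (((a + 1 : ℕ) : ℂ) + κ))
        ((((a + 1 : ℕ) : ℂ) + κ) * ((1 + s : ℝ) : ℂ) ^ (((a + 1 : ℕ) : ℂ) + κ - 1) * 1) s := by
      have h : HasDerivAt (fun z : ℂ => (1 + z) ^ (((a + 1 : ℕ) : ℂ) + κ))
          ((((a + 1 : ℕ) : ℂ) + κ) * (1 + (s : ℂ)) ^ (((a + 1 : ℕ) : ℂ) + κ - 1) * 1) (s : ℂ) := by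
        refine ((hasDerivAt_id (s : ℂ)).const_add 1).cpow_const ?_
        simpa using Complex.ofReal_mem_slitPlane.2 h1
      simpa only [Complex.ofReal_add, Complex.ofReal_one] using h.comp_ofReal
    have d3 : HasDerivAt (fun s : ℝ => Complex.exp (-((c * s : ℝ) : ℂ)))
        (Complex.exp (-((c * s : ℝ) : ℂ)) * (-(c : ℂ))) s := by
      refine HasDerivAt.cexp ?_
      have := (((hasDerivAt_id s).const_mul c).ofReal_comp).neg
      rw [mul_one] at this
      exact this
    refine ((d1.mul d2).mul d3).congr_deriv ?_
    have key : ∀ b j : ℕ, whittakerKernel κ c b j s = (s : ℂ) ^ j * ((s : ℂ) * (1 + s)) ^ b *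
        whittakerKernel κ c 0 0 s := by
      intro b j
      simpa using whittakerKernel_eq_mul κ c 0 b j hs
    have e1 : ((a + 1 : ℕ) : ℂ) + k - κ - 1 = ((a + k : ℕ) : ℂ) +
        (((0 : ℕ) : ℂ) + ((0 : ℕ) : ℂ) - κ) := by push_cast; ring
    have e2 : ((a + 1 : ℕ) : ℂ) + κ - 1 = (a : ℂ) + (((0 : ℕ) : ℂ) + κ) := by push_cast; ring
    have e3 : ((a + 1 : ℕ) : ℂ) + k - κ = ((a + 1 + k : ℕ) : ℂ) +
        (((0 : ℕ) : ℂ) + ((0 : ℕ) : ℂ) - κ) := by push_cast; ring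
    have e4 : ((a + 1 : ℕ) : ℂ) + κ = ((a + 1 : ℕ) : ℂ) + (((0 : ℕ) : ℂ) + κ) := by
      push_cast; ring
    have h1'' : ((1 + s : ℝ) : ℂ) ≠ 0 := by exact_mod_cast h1'
    simp only [hF']
    rw [key a k, key a (k + 1), key (a + 1) k, e1, e2]
    simp only [Pi.mul_apply, e3, e4, whittakerKernel]
    simp only [Complex.cpow_add _ _ hs', Complex.cpow_add _ _ h1'', Complex.cpow_natCast, mul_pow]
    push_cast
    ring
  have hcont : ContinuousWithinAt (whittakerKernel κ c (a + 1) k) (Set.Ici 0) 0 := by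
    apply ContinuousAt.continuousWithinAt
    unfold whittakerKernel
    refine ((Complex.continuous_ofReal_cpow_const hre).continuousAt.mul
      (ContinuousAt.cpow (by fun_prop) continuousAt_const ?_)).mul (by fun_prop)
    simp
  have hzero : whittakerKernel κ c (a + 1) k 0 = 0 := by
    rw [whittakerKernel, Complex.ofReal_zero, Complex.zero_cpow hne, zero_mul, zero_mul]
  have hlim := tendsto_zero_of_hasDerivAt_of_integrableOn_Ioi hderiv hint (hI (a + 1) k)
  have := integral_Ioi_of_hasDerivAt_of_tendsto hcont hderiv hint hlim
  have hsplit : ∫ s in Set.Ioi (0 : ℝ), F' s =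
      ((a : ℂ) + k + 1 - κ) * whittakerIntegral κ c a k +
        (2 * (a : ℂ) + 2 + k) * whittakerIntegral κ c a (k + 1) -
          c * whittakerIntegral κ c (a + 1) k := by
    simp only [whittakerIntegral, ← integral_const_mul]
    rw [← integral_add hI1 hI2, ← integral_sub hI12 hI3]
  rw [hsplit, hzero, sub_zero, sub_eq_zero] at this
  exact this.symm

/-- Inversion of the two-index recurrence satisfied by the normalised kernel integrals. -/
lemma sum_range_eq_of_succ_eq_add {β : ℕ → ℕ → ℂ}
    (hβ : ∀ a k, β (a + 1) k = β a k + (2 * (a : ℂ) + 2 + k) * β a (k + 1)) (N k : ℕ) :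
    ∑ l ∈ Finset.range (N + 1), (-1 : ℂ) ^ l * (2 * l + 1 + k) * (l + k).factorial /
        ((N + l + 1 + k).factorial * (N - l).factorial * l.factorial) * β l k =
      (-1) ^ N / N.factorial * β 0 (N + k) := by
  induction N generalizing k with
  | zero =>
    have h : (1 + k : ℂ) ≠ 0 := by exact_mod_cast (by omega : 1 + k ≠ 0)
    have h' : (k.factorial : ℂ) ≠ 0 := by exact_mod_cast k.factorial_ne_zero
    have e : ((0 + 0 + 1 + k).factorial : ℂ) = (1 + k) * k.factorial := by
      rw [show 0 + 0 + 1 + k = k + 1 by ring, Nat.factorial_succ]; push_cast; ring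
    simp only [zero_add, Finset.sum_range_one] at e ⊢
    rw [e]
    simp
    field_simp
  | succ N ih =>
    set C : ℕ → ℂ := fun l => (-1 : ℂ) ^ l * (l + (k + 1)).factorial /
      ((N + l + 1 + (k + 1)).factorial * (N - l).factorial * l.factorial) / (N + 1) with hC
    have hN : (N + 1 : ℂ) ≠ 0 := by exact_mod_cast N.succ_ne_zero
    have fne : ∀ n : ℕ, (n.factorial : ℂ) ≠ 0 := fun n => by exact_mod_cast n.factorial_ne_zero
    have hpartial : ∀ m ≤ N, ∑ l ∈ Finset.range (m + 1), (-1 : ℂ) ^ l * (2 * l + 1 + k) *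
        (l + k).factorial / ((N + 1 + l + 1 + k).factorial * (N + 1 - l).factorial *
          l.factorial) * β l k =
        C m * β (m + 1) k -
          ∑ l ∈ Finset.range (m + 1), C l * (2 * l + 2 + k) * β l (k + 1) := by
      intro m hm
      induction m with
      | zero =>
        rw [Finset.sum_range_one, Finset.sum_range_one, hβ]
        have e1 : ((N + 0 + 1 + (k + 1)).factorial : ℂ) = (N + 1 + 0 + 1 + k).factorial := by
          congr 2; ring
        have e2 : ((0 + (k + 1)).factorial : ℂ) = (1 + k) * (0 + k).factorial := by
          rw [zero_add, zero_add, Nat.factorial_succ]; push_cast; ring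
        have e3 : ((N + 1 - 0).factorial : ℂ) = (N + 1) * (N - 0).factorial := by
          simp [Nat.factorial_succ]
        simp only [hC, e1, e2, e3]
        have := fne (N + 1 + 0 + 1 + k)
        have := fne (N - 0)
        push_cast
        field_simp
        ring
      | succ m ihm =>
        rw [Finset.sum_range_succ, ihm (by omega), Finset.sum_range_succ _ (m + 1), hβ (m + 1) k]
        obtain ⟨j, rfl⟩ : ∃ j, N = m + 1 + j := ⟨N - (m + 1), by omega⟩
        have e : C m + (-1 : ℂ) ^ (m + 1) * (2 * (m + 1 : ℕ) + 1 + k) *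
            (m + 1 + k).factorial / ((m + 1 + j + 1 + (m + 1) + 1 + k).factorial *
              (m + 1 + j + 1 - (m + 1)).factorial * (m + 1).factorial) = C (m + 1) := by
          simp only [hC]
          rw [show m + 1 + j + 1 - (m + 1) = j + 1 by omega, show m + 1 + j - m = j + 1 by omega,
            show m + 1 + j - (m + 1) = j by omega,
            show m + 1 + j + 1 + (m + 1) + 1 + k = (m + 1 + j + m + 1 + (k + 1)) + 1 by ring,
            show m + 1 + j + (m + 1) + 1 + (k + 1) = (m + 1 + j + m + 1 + (k + 1)) + 1 by ring,
            show m + (k + 1) = m + 1 + k by ring,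
            show m + 1 + (k + 1) = (m + 1 + k) + 1 by ring, Nat.factorial_succ j,
            Nat.factorial_succ m, Nat.factorial_succ (m + 1 + k),
            Nat.factorial_succ (m + 1 + j + m + 1 + (k + 1))]
          have h1 := fne j
          have h2 := fne m
          have h3 := fne (m + 1 + j + m + 1 + (k + 1))
          have h4 : (j + 1 : ℂ) ≠ 0 := by exact_mod_cast j.succ_ne_zero
          have h5 : (m + 1 : ℂ) ≠ 0 := by exact_mod_cast m.succ_ne_zero
          have h6 : (m + 1 + j + m + 1 + (k + 1) + 1 : ℂ) ≠ 0 := by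
            exact_mod_cast Nat.succ_ne_zero (m + 1 + j + m + 1 + (k + 1))
          push_cast at hN ⊢
          field_simp
          ring
        rw [← e]
        push_cast
        ring
    have hlast : (-1 : ℂ) ^ (N + 1) * (2 * (N + 1 : ℕ) + 1 + k) * (N + 1 + k).factorial /
        ((N + 1 + (N + 1) + 1 + k).factorial * (N + 1 - (N + 1)).factorial *
          (N + 1).factorial) = -C N := by
      simp only [hC]
      rw [show N + 1 + (N + 1) + 1 + k = (N + N + 1 + (k + 1)) + 1 by ring,
        show N + (k + 1) = N + 1 + k by ring, Nat.factorial_succ N,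
        Nat.factorial_succ (N + N + 1 + (k + 1)), Nat.sub_self, Nat.sub_self]
      have h2 := fne N
      have h3 := fne (N + N + 1 + (k + 1))
      have h6 : (N + N + 1 + (k + 1) + 1 : ℂ) ≠ 0 := by
        exact_mod_cast Nat.succ_ne_zero (N + N + 1 + (k + 1))
      push_cast
      rw [show (2 * ((N : ℂ) + 1) + 1 + k) = N + N + 1 + (k + 1) + 1 by ring]
      generalize (N + N + 1 + (k + 1) + 1 : ℂ) = x at h6 ⊢
      field_simp
      ring
    rw [Finset.sum_range_succ, hpartial N le_rfl, hlast]
    have hih := ih (k + 1)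
    have hsum : ∑ l ∈ Finset.range (N + 1), C l * (2 * l + 2 + k) * β l (k + 1) =
        (N + 1 : ℂ)⁻¹ * ((-1) ^ N / N.factorial * β 0 (N + (k + 1))) := by
      rw [← hih, Finset.mul_sum]
      refine Finset.sum_congr rfl fun l _ => ?_
      simp only [hC]
      push_cast
      ring
    rw [hsum, show N + 1 + k = N + (k + 1) by ring, Nat.factorial_succ]
    have := fne N
    push_cast
    field_simp
    ring

lemma aP_one_sub_ne_zero {κ : ℂ} (hκ : κ.re < 1) (n : ℕ) : aP n (1 - κ) ≠ 0 := by
  rw [aP, Ne, ascPochhammer_eval_eq_zero_iff]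
  rintro ⟨k, -, h⟩
  have := congrArg Complex.re h
  simp at this
  linarith [(Nat.cast_nonneg k : (0 : ℝ) ≤ k)]

lemma aP_add (m n : ℕ) (a : ℂ) : aP (m + n) a = aP m a * aP n (a + m) := by
  simp [aP, ← ascPochhammer_mul, Polynomial.eval_comp]

/-- The Taylor coefficients, in the second variable, of the double series expansion. -/
lemma sum_range_whittakerIntegral {κ : ℂ} (hκ : κ.re < 1) {c : ℝ} (hc : 0 < c) (N : ℕ) :
    ∑ l ∈ Finset.range (N + 1), (-1 : ℂ) ^ l * (2 * l + 1) /
        ((N + l + 1).factorial * (N - l).factorial) * aP (N - l) (l + 1 - κ) *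
          ((c : ℂ) ^ l * whittakerIntegral κ c l 0) =
      (-1) ^ N / N.factorial * whittakerIntegral κ c 0 N := by
  have hg := aP_one_sub_ne_zero hκ
  have hrec : ∀ a k : ℕ, (c : ℂ) ^ (a + 1) * whittakerIntegral κ c (a + 1) k /
        aP (a + 1 + k) (1 - κ) =
      (c : ℂ) ^ a * whittakerIntegral κ c a k / aP (a + k) (1 - κ) + (2 * (a : ℂ) + 2 + k) *
        ((c : ℂ) ^ a * whittakerIntegral κ c a (k + 1) / aP (a + (k + 1)) (1 - κ)) := by
    intro a k
    have h1 : aP (a + k + 1) (1 - κ) = aP (a + k) (1 - κ) * ((a : ℂ) + k + 1 - κ) := by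
      rw [aP, ascPochhammer_succ_eval, aP]; push_cast; ring
    have h2 := hg (a + k + 1)
    have h3 : ((a : ℂ) + k + 1 - κ) ≠ 0 := fun h => h2 (by rw [h1, h, mul_zero])
    rw [show a + 1 + k = a + k + 1 by ring, ← add_assoc a k 1, h1, pow_succ, mul_assoc,
      mul_whittakerIntegral_succ hκ hc]
    have h4 := hg (a + k)
    field_simp
  have := sum_range_eq_of_succ_eq_add
    (β := fun a k => (c : ℂ) ^ a * whittakerIntegral κ c a k / aP (a + k) (1 - κ)) hrec N 0
  simp only [add_zero, Nat.cast_zero, pow_zero, zero_add, one_mul] at this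
  have h5 := hg N
  have h6 : (-1 : ℂ) ^ N / N.factorial * whittakerIntegral κ c 0 N = aP N (1 - κ) *
      ((-1) ^ N / N.factorial * (whittakerIntegral κ c 0 N / aP N (1 - κ))) := by
    field_simp
  rw [h6, ← this, Finset.mul_sum]
  refine Finset.sum_congr rfl fun l hl => ?_
  have hl : l ≤ N := Nat.lt_succ_iff.1 (Finset.mem_range.1 hl)
  have h7 : aP N (1 - κ) = aP l (1 - κ) * aP (N - l) (l + 1 - κ) := by
    conv_lhs => rw [← Nat.add_sub_cancel' hl, aP_add]
    congr 2; ring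
  have h8 := hg l
  have h9 : (l.factorial : ℂ) ≠ 0 := by exact_mod_cast l.factorial_ne_zero
  have h10 : ((N + l + 1).factorial : ℂ) ≠ 0 := by exact_mod_cast (N + l + 1).factorial_ne_zero
  have h11 : ((N - l).factorial : ℂ) ≠ 0 := by exact_mod_cast (N - l).factorial_ne_zero
  rw [h7]
  field_simp

lemma factorial_mul_aP (m n : ℕ) :
    (m.factorial : ℂ) * aP n (m + 1) = (m + n).factorial := by
  induction n with
  | zero => simp [aP]
  | succ n ih =>
    rw [aP, ascPochhammer_succ_eval, ← aP, ← mul_assoc, ih, ← add_assoc, Nat.factorial_succ]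
    push_cast
    ring

lemma norm_aP_div_aP_le (κ : ℂ) (l n : ℕ) :
    ‖aP n ((l : ℂ) + 1 - κ) / aP n (2 * (l : ℂ) + 2)‖ ≤ (1 + ‖κ‖) ^ n := by
  induction n with
  | zero => simp [aP]
  | succ n ih =>
    rw [aP, aP, ascPochhammer_succ_eval, ascPochhammer_succ_eval, ← aP, ← aP, mul_div_mul_comm,
      norm_mul, pow_succ]
    refine mul_le_mul ih ?_ (norm_nonneg _) (by positivity)
    have h1 : ‖(2 * (l : ℂ) + 2 + n)‖ = 2 * l + 2 + n := by
      rw [show (2 * (l : ℂ) + 2 + n) = ((2 * l + 2 + n : ℕ) : ℂ) by push_cast; ring,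
        Complex.norm_natCast]
      push_cast; ring
    have h2 : ‖(l : ℂ) + 1 - κ + n‖ ≤ l + 1 + n + ‖κ‖ := by
      rw [show (l : ℂ) + 1 - κ + n = ((l + 1 + n : ℕ) : ℂ) - κ by push_cast; ring]
      refine (norm_sub_le _ _).trans ?_
      rw [Complex.norm_natCast]
      push_cast; rfl
    rw [norm_div, h1, div_le_iff₀ (by positivity)]
    refine h2.trans ?_
    have : (0 : ℝ) ≤ l := l.cast_nonneg
    have : (0 : ℝ) ≤ n := n.cast_nonneg
    nlinarith [norm_nonneg κ, mul_nonneg (norm_nonneg κ) (by positivity : (0 : ℝ) ≤ 2 * l + 1 + n)]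

lemma cosh_le_exp_of_nonneg {x : ℝ} (hx : 0 ≤ x) : Real.cosh x ≤ Real.exp x := by
  rw [Real.cosh_eq]
  linarith [Real.exp_le_exp.2 (by linarith : -x ≤ x)]

lemma summable_norm_whittakerIntegral {κ : ℂ} (hκ : κ.re < 1) {r₀ r : ℝ} (hr₀ : 0 < r₀)
    (hr : r₀ < r) :
    Summable fun l : ℕ => (r₀ * r) ^ l / (2 * l).factorial * ‖whittakerIntegral κ r l 0‖ := by
  have hr' : 0 < r := hr₀.trans hr
  set q : ℝ := √(r₀ * r) with hq
  have hq0 : 0 < q := Real.sqrt_pos.2 (by positivity)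
  have hq2 : q ^ 2 = r₀ * r := Real.sq_sqrt (by positivity)
  have hqr : 0 < r - q := by
    have : q < r := by
      rw [hq, Real.sqrt_lt' hr']
      nlinarith
    linarith
  have hnorm : ∀ l : ℕ, IntegrableOn (fun s => (r₀ * r) ^ l / (2 * l).factorial *
      ‖whittakerKernel κ r l 0 s‖) (Set.Ioi 0) := fun l =>
    (integrableOn_whittakerKernel hκ hr' l 0).norm.const_mul _
  refine summable_of_sum_le (c := ∫ s in Set.Ioi (0 : ℝ),
    Real.exp (q / 2) * ‖whittakerKernel κ (r - q) 0 0 s‖) (fun l => by positivity) fun u => ?_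
  calc ∑ l ∈ u, (r₀ * r) ^ l / (2 * l).factorial * ‖whittakerIntegral κ r l 0‖
      ≤ ∑ l ∈ u, ∫ s in Set.Ioi (0 : ℝ), (r₀ * r) ^ l / (2 * l).factorial *
          ‖whittakerKernel κ r l 0 s‖ := by
        refine Finset.sum_le_sum fun l _ => ?_
        rw [integral_const_mul]
        gcongr
        exact norm_integral_le_integral_norm _
    _ = ∫ s in Set.Ioi (0 : ℝ), ∑ l ∈ u, (r₀ * r) ^ l / (2 * l).factorial *
          ‖whittakerKernel κ r l 0 s‖ := (integral_finsetSum _ fun l _ => hnorm l).symm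
    _ ≤ _ := by
        refine setIntegral_mono_on (integrable_finsetSum _ fun l _ => hnorm l)
          ((integrableOn_whittakerKernel hκ hqr 0 0).norm.const_mul _) measurableSet_Ioi
          fun s hs => ?_
        have hs : 0 < s := hs
        have hterm : ∀ l ∈ u, (r₀ * r) ^ l / (2 * l).factorial * ‖whittakerKernel κ r l 0 s‖ ≤
            (q * (s + 1 / 2)) ^ (2 * l) / (2 * l).factorial * ‖whittakerKernel κ r 0 0 s‖ := by
          intro l _
          have hk : ‖whittakerKernel κ r l 0 s‖ =
              (s * (1 + s)) ^ l * ‖whittakerKernel κ r 0 0 s‖ := by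
            have := whittakerKernel_eq_mul κ r 0 l 0 hs
            rw [add_zero] at this
            rw [this, norm_mul]
            congr 1
            have : (s : ℂ) ^ 0 * ((s : ℂ) * (1 + s)) ^ l * Complex.exp (-((0 * s : ℝ) : ℂ)) =
              (((s * (1 + s)) ^ l : ℝ) : ℂ) := by push_cast; simp
            rw [this, Complex.norm_real, Real.norm_of_nonneg (by positivity)]
          rw [hk, ← mul_assoc, div_mul_eq_mul_div, ← mul_pow, pow_mul, mul_pow q, hq2]
          gcongr
          nlinarith
        have hexp : ‖whittakerKernel κ (r - q) 0 0 s‖ =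
            Real.exp (q * s) * ‖whittakerKernel κ r 0 0 s‖ := by
          have := whittakerKernel_eq_mul κ r (-q) 0 0 hs
          rw [← sub_eq_add_neg] at this
          rw [this, norm_mul]
          simp [Complex.norm_exp]
        have hsum : ∑ l ∈ u, (q * (s + 1 / 2)) ^ (2 * l) / (2 * l).factorial ≤
            Real.exp (q * (s + 1 / 2)) :=
          (sum_le_hasSum u (fun l _ => by positivity) (Real.hasSum_cosh _)).trans
            (cosh_le_exp_of_nonneg (by positivity))
        calc _ ≤ _ := Finset.sum_le_sum hterm
          _ = (∑ l ∈ u, (q * (s + 1 / 2)) ^ (2 * l) / (2 * l).factorial) *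
              ‖whittakerKernel κ r 0 0 s‖ := by rw [Finset.sum_mul]
          _ ≤ Real.exp (q * (s + 1 / 2)) * ‖whittakerKernel κ r 0 0 s‖ := by gcongr
          _ = _ := by
            rw [hexp, ← mul_assoc, ← Real.exp_add]
            congr 2; ring

/-- The Taylor expansion of the kernel integral in its second argument. -/
lemma hasSum_whittakerIntegral {κ : ℂ} (hκ : κ.re < 1) {r₀ r : ℝ} (hr₀ : 0 < r₀)
    (hr : r₀ < r) :
    HasSum (fun N : ℕ => (r₀ : ℂ) ^ N * ((-1) ^ N / N.factorial * whittakerIntegral κ r 0 N))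
      (whittakerIntegral κ (r + r₀) 0 0) := by
  have hr' : 0 < r := hr₀.trans hr
  have hterm : ∀ N : ℕ, ∀ s ∈ Set.Ioi (0 : ℝ),
      (r₀ : ℂ) ^ N * ((-1) ^ N / N.factorial * whittakerKernel κ r 0 N s) =
        (-((r₀ * s : ℝ) : ℂ)) ^ N / N.factorial * whittakerKernel κ r 0 0 s := by
    intro N s hs
    have := whittakerKernel_eq_mul κ r 0 0 N hs
    rw [add_zero] at this
    rw [this, neg_pow, Complex.ofReal_mul, mul_pow]
    simp
    ring
  have hexp : ∀ x : ℝ, HasSum (fun N : ℕ => x ^ N / N.factorial) (Real.exp x) := by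
    intro x
    rw [Real.exp_eq_exp_ℝ]
    exact NormedSpace.expSeries_div_hasSum_exp x
  have hcexp : ∀ x : ℂ, HasSum (fun N : ℕ => x ^ N / N.factorial) (Complex.exp x) := by
    intro x
    rw [Complex.exp_eq_exp_ℂ]
    exact NormedSpace.expSeries_div_hasSum_exp x
  have hbound : ∀ s : ℝ, HasSum (fun N : ℕ => (r₀ * s) ^ N / N.factorial *
      ‖whittakerKernel κ r 0 0 s‖) (Real.exp (r₀ * s) * ‖whittakerKernel κ r 0 0 s‖) :=
    fun s => (hexp _).mul_right _
  simp only [whittakerIntegral, ← integral_const_mul]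
  refine hasSum_integral_of_dominated_convergence
    (fun N s => (r₀ * s) ^ N / N.factorial * ‖whittakerKernel κ r 0 0 s‖)
    (fun N => ?_) (fun N => ?_) (.of_forall fun s => (hbound s).summable) ?_ ?_
  · exact (((integrableOn_whittakerKernel hκ hr' 0 N).const_mul _).const_mul _).aestronglyMeasurable
  · refine (ae_restrict_iff' measurableSet_Ioi).2 (.of_forall fun s hs => ?_)
    have hs' : 0 < s := hs
    rw [hterm N s hs, norm_mul, norm_div, norm_pow, norm_neg, Complex.norm_real,
      Real.norm_of_nonneg (by positivity), Complex.norm_natCast]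
  · simp only [fun s => (hbound s).tsum_eq]
    refine ((integrableOn_whittakerKernel hκ (sub_pos.2 hr) 0 0).norm).congr ?_
    refine (ae_restrict_iff' measurableSet_Ioi).2 (.of_forall fun s hs => ?_)
    have := whittakerKernel_eq_mul κ r (-r₀) 0 0 hs
    rw [← sub_eq_add_neg] at this
    simp only [this, norm_mul]
    simp [Complex.norm_exp]
  · refine (ae_restrict_iff' measurableSet_Ioi).2 (.of_forall fun s hs => ?_)
    have h := (hcexp (-((r₀ * s : ℝ) : ℂ))).mul_right (whittakerKernel κ r 0 0 s)
    simp only [hterm _ s hs]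
    rw [whittakerKernel_eq_mul κ r r₀ 0 0 hs]
    simpa using h

lemma whittakerW_eq (κ : ℂ) (l : ℕ) {R : ℝ} (hR : 0 < R) :
    whittakerW κ ((l : ℂ) + 1 / 2) R = Complex.exp (-(R : ℂ) / 2) *
      (Complex.Gamma ((l : ℂ) + 1 - κ))⁻¹ * (R : ℂ) ^ (l + 1) * whittakerIntegral κ R l 0 := by
  have hR' : (R : ℂ) ≠ 0 := by exact_mod_cast hR.ne'
  have hsub := integral_comp_mul_left_Ioi (fun t : ℝ => (t : ℂ) ^ ((l : ℂ) - κ) *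
    ((1 + t / R : ℝ) : ℂ) ^ ((l : ℂ) + κ) * Complex.exp (-(t : ℂ))) 0 hR
  rw [mul_zero, eq_inv_smul_iff₀ hR.ne'] at hsub
  have hker : ∫ s in Set.Ioi (0 : ℝ), ((R * s : ℝ) : ℂ) ^ ((l : ℂ) - κ) *
      ((1 + R * s / R : ℝ) : ℂ) ^ ((l : ℂ) + κ) * Complex.exp (-((R * s : ℝ) : ℂ)) =
      (R : ℂ) ^ ((l : ℂ) - κ) * whittakerIntegral κ R l 0 := by
    rw [whittakerIntegral, ← integral_const_mul]
    refine setIntegral_congr_fun measurableSet_Ioi fun s hs => ?_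
    have hs : 0 < s := hs
    simp only [whittakerKernel]
    rw [mul_div_cancel_left₀ s hR.ne', Complex.ofReal_mul,
      Complex.mul_cpow_ofReal_nonneg hR.le hs.le, Nat.cast_zero, add_zero]
    ring
  rw [hker] at hsub
  have hpow : (R : ℂ) ^ κ * (R * (R : ℂ) ^ ((l : ℂ) - κ)) = (R : ℂ) ^ (l + 1) := by
    have : (R : ℂ) * (R : ℂ) ^ ((l : ℂ) - κ) = (R : ℂ) ^ ((1 : ℂ) + ((l : ℂ) - κ)) := by
      rw [Complex.cpow_add _ _ hR', Complex.cpow_one]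
    rw [this, ← Complex.cpow_add _ _ hR', ← Complex.cpow_natCast]
    congr 1
    push_cast; ring
  rw [whittakerW, show (l : ℂ) + 1 / 2 - κ + 1 / 2 = l + 1 - κ by ring,
    show (l : ℂ) + 1 / 2 - κ - 1 / 2 = l - κ by ring,
    show (l : ℂ) + 1 / 2 + κ - 1 / 2 = l + κ by ring, ← hsub, ← hpow, Complex.real_smul]
  ring

/-- The double series expansion of the kernel integral at `r + r₀`. -/
lemma hasSum_whittakerIntegral_mul_tsum {κ : ℂ} (hκ : κ.re < 1) {r₀ r : ℝ} (hr₀ : 0 < r₀)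
    (hr : r₀ < r) :
    HasSum (fun l : ℕ => (-1) ^ l * ((r₀ * r : ℂ) ^ l / (2 * l).factorial *
        whittakerIntegral κ r l 0) * ∑' n : ℕ, aP n ((l : ℂ) + 1 - κ) /
          (aP n (2 * (l : ℂ) + 2) * (n.factorial : ℂ)) * (r₀ : ℂ) ^ n)
      (whittakerIntegral κ (r + r₀) 0 0) := by
  have hr' : 0 < r := hr₀.trans hr
  set f : ℕ × ℕ → ℂ := fun p => (-1) ^ p.1 * ((r₀ * r : ℂ) ^ p.1 / (2 * p.1).factorial *
    whittakerIntegral κ r p.1 0) * (aP p.2 ((p.1 : ℂ) + 1 - κ) /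
      (aP p.2 (2 * (p.1 : ℂ) + 2) * (p.2.factorial : ℂ)) * (r₀ : ℂ) ^ p.2) with hf
  have hsummable : Summable f := by
    have hprod := (summable_norm_whittakerIntegral hκ hr₀ hr).mul_of_nonneg
      (Real.summable_pow_div_factorial ((1 + ‖κ‖) * r₀)) (fun l => by positivity)
      (fun n => by positivity)
    refine Summable.of_norm_bounded hprod fun p => ?_
    have h1 : ‖(-1 : ℂ) ^ p.1 * ((r₀ * r : ℂ) ^ p.1 / (2 * p.1).factorial *
        whittakerIntegral κ r p.1 0)‖ =
        (r₀ * r) ^ p.1 / (2 * p.1).factorial * ‖whittakerIntegral κ r p.1 0‖ := by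
      simp [abs_of_pos hr₀, abs_of_pos hr']
    have h2 : ‖aP p.2 ((p.1 : ℂ) + 1 - κ) / (aP p.2 (2 * (p.1 : ℂ) + 2) *
        (p.2.factorial : ℂ)) * (r₀ : ℂ) ^ p.2‖ ≤
        ((1 + ‖κ‖) * r₀) ^ p.2 / p.2.factorial := by
      rw [← div_div, norm_mul, norm_div, norm_pow, Complex.norm_natCast, Complex.norm_real,
        Real.norm_of_nonneg hr₀.le, mul_pow, div_mul_eq_mul_div]
      gcongr
      exact norm_aP_div_aP_le κ p.1 p.2
    rw [hf]
    simp only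
    rw [norm_mul, h1]
    gcongr
  have hdiag : HasSum (fun N : ℕ => ∑ p ∈ Finset.HasAntidiagonal.antidiagonal N, f p) (∑' p, f p) := by
    have h := (Finset.HasAntidiagonal.sigmaAntidiagonalEquivProd (A := ℕ)).hasSum_iff.2
      hsummable.hasSum
    exact h.sigma fun N => Finset.hasSum (Finset.HasAntidiagonal.antidiagonal N) f
  have hcoef : ∀ N : ℕ, ∑ p ∈ Finset.HasAntidiagonal.antidiagonal N, f p =
      (r₀ : ℂ) ^ N * ((-1) ^ N / N.factorial * whittakerIntegral κ r 0 N) := by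
    intro N
    rw [← sum_range_whittakerIntegral hκ hr' N, Finset.mul_sum,
      Finset.Nat.sum_antidiagonal_eq_sum_range_succ_mk]
    refine Finset.sum_congr rfl fun l hl => ?_
    obtain ⟨n, rfl⟩ := Nat.exists_eq_add_of_le (Nat.lt_succ_iff.1 (Finset.mem_range.1 hl))
    have h1 := factorial_mul_aP (2 * l + 1) n
    rw [show ((2 * l + 1 : ℕ) : ℂ) + 1 = 2 * l + 2 by push_cast; ring,
      show 2 * l + 1 + n = l + n + l + 1 by ring, Nat.factorial_succ (2 * l)] at h1
    have h2 : ((l + n + l + 1).factorial : ℂ) ≠ 0 := by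
      exact_mod_cast (l + n + l + 1).factorial_ne_zero
    have h3 : (n.factorial : ℂ) ≠ 0 := by exact_mod_cast n.factorial_ne_zero
    have h4 : ((2 * l).factorial : ℂ) ≠ 0 := by exact_mod_cast (2 * l).factorial_ne_zero
    have h5 : aP n (2 * (l : ℂ) + 2) ≠ 0 := fun h => h2 (by rw [← h1, h, mul_zero])
    have h6 : (2 * l + 1 : ℂ) ≠ 0 := by exact_mod_cast (2 * l).succ_ne_zero
    simp only [hf, Nat.add_sub_cancel_left]
    rw [← h1]
    push_cast
    rw [mul_pow, pow_add]
    generalize (2 * l + 1 : ℂ) = d at h6 ⊢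
    field_simp
  have hS := hdiag.unique ((hasSum_whittakerIntegral hκ hr₀ hr).congr_fun hcoef)
  rw [← hS]
  refine hsummable.hasSum.prod_fiberwise fun l => ?_
  have := (hsummable.prod_factor l).hasSum
  simp only [hf, tsum_mul_left] at this
  exact this

/-- The `γ = π` special case of the addition formula for the Whittaker functions. -/
theorem whittaker_addition_formula_gamma_pi (κ : ℂ) (hκ : κ.re < 1) (r₀ r : ℝ)
    (hr₀ : 0 < r₀) (hr : r₀ < r) :
    HasSum
      (fun ℓ : ℕ =>
        (1 / (r * r₀ : ℂ)) * (-1) ^ ℓ *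
          (Complex.Gamma ((ℓ : ℂ) + 1 - κ) / ((2 * ℓ).factorial : ℂ)) *
          whittakerM κ ℓ (r₀ : ℂ) * whittakerW κ ((ℓ : ℂ) + 1 / 2) r)
      ((Complex.Gamma (1 - κ) / (r + r₀ : ℂ)) * whittakerW κ (1 / 2) (r + r₀)) := by
  have hr' : 0 < r := hr₀.trans hr
  have hrC : (r : ℂ) ≠ 0 := by exact_mod_cast hr'.ne'
  have hr₀C : (r₀ : ℂ) ≠ 0 := by exact_mod_cast hr₀.ne'
  have hsumC : (r + r₀ : ℂ) ≠ 0 := by exact_mod_cast (add_pos hr' hr₀).ne'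
  have hΓ : ∀ l : ℕ, Complex.Gamma ((l : ℂ) + 1 - κ) ≠ 0 := fun l =>
    Complex.Gamma_ne_zero_of_re_pos (by
      have : (0 : ℝ) ≤ l := l.cast_nonneg
      simp; linarith)
  have hexp : Complex.exp (-((r + r₀ : ℝ) : ℂ) / 2) =
      Complex.exp (-(r₀ : ℂ) / 2) * Complex.exp (-(r : ℂ) / 2) := by
    rw [← Complex.exp_add]; congr 1; push_cast; ring
  have hW := whittakerW_eq κ 0 (add_pos hr' hr₀)
  have hΓ0 := hΓ 0
  simp only [Nat.cast_zero, zero_add, pow_one] at hW hΓ0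
  convert! (hasSum_whittakerIntegral_mul_tsum hκ hr₀ hr).mul_left
    (Complex.exp (-(r₀ : ℂ) / 2) * Complex.exp (-(r : ℂ) / 2)) using 1
  · funext l
    have := hΓ l
    rw [whittakerW_eq κ l hr', whittakerM, mul_pow]
    field_simp
    ring
  · rw [hW, hexp]
    push_cast
    field_simp
end
end
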